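/- arXiv:1801.09618 — 11 statements merged into one kernel-verified Lean document; each statement's English description precedes it below -/
import Mathlib

section
/- Let G be a parity game with n vertices and d priorities. If μ : V → {0,…,n}^{d/2} ∪ {⊤} is a signature and v ∈ V satisfies μ(v) ≠ ⊤, then Eve wins from v. -/
/-- A parity game: a finite directed graph in which every vertex has at least one
outgoing edge, a partition of vertices between Eve (`EveV`) and Adam (the complement),
and a priority function `c : V → {1, …, d}`. -/
structure ParityGame where
  V : Type
  [fintypeV : Fintype V]
  E : V → V → Prop
  exists_succ : ∀ v, ∃ w, E v w
  EveV : Set V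
  d : ℕ
  c : V → ℕ
  c_pos : ∀ v, 1 ≤ c v
  c_le_d : ∀ v, c v ≤ d

attribute [instance] ParityGame.fintypeV

namespace ParityGame

variable (G : ParityGame)

/-- A play from `v0`: an infinite sequence of vertices starting at `v0` and following edges. -/
def IsPlay (v0 : G.V) (π : ℕ → G.V) : Prop :=
  π 0 = v0 ∧ ∀ i, G.E (π i) (π (i + 1))

/-- The parity objective: the largest priority occurring infinitely often is even. -/
def SatParity (π : ℕ → G.V) : Prop :=
  Even (sSup {p | ∀ N, ∃ i, N ≤ i ∧ G.c (π i) = p})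

/-- A strategy for Eve: maps a (finite) history together with the current vertex
(so together: a finite nonempty sequence of vertices ending in a vertex of `EveV`)
to a next vertex, always following an edge. -/
structure EveStrategy (G : ParityGame) where
  move : List G.V → G.V → G.V
  follows : ∀ l v, v ∈ G.EveV → G.E v (move l v)

/-- A play is consistent with Eve's strategy `σ` if whenever `π i ∈ EveV`,
the next vertex is the one prescribed by `σ` applied to `π₀ … π_i`. -/
def ConsistentE (σ : EveStrategy G) (π : ℕ → G.V) : Prop :=
  ∀ i, π i ∈ G.EveV → π (i + 1) = σ.move ((List.range i).map π) (π i)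

/-- Eve wins the objective `Ω` from `v0`. -/
def EveWinsObj (Ω : (ℕ → G.V) → Prop) (v0 : G.V) : Prop :=
  ∃ σ : EveStrategy G, ∀ π, G.IsPlay v0 π → G.ConsistentE σ π → Ω π

/-- Eve wins (the parity objective) from `v0`. -/
def EveWinsFrom (v0 : G.V) : Prop :=
  G.EveWinsObj G.SatParity v0

end ParityGame

/-- The restriction of a tuple in `{0,…,n}^{d/2}` — whose coordinates are indexed by the odd
priorities `d−1, d−3, …, 1`, larger priorities more significant (first) — to the coordinates
indexed by odd priorities `≥ p`, as a list. -/
def restrT (d : ℕ) (x : Fin (d / 2) → ℕ) (p : ℕ) : List ℕ :=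
  (List.ofFn x).take ((d - p + 1) / 2)

/-- `x ≥_p y` for tuples: lexicographic comparison of the restrictions to odd priorities `≥ p`. -/
def tupGe (d p : ℕ) (x y : Fin (d / 2) → ℕ) : Prop :=
  restrT d x p = restrT d y p ∨ List.Lex (· < ·) (restrT d y p) (restrT d x p)

/-- `x >_p y` for tuples: strict lexicographic comparison of restrictions. -/
def tupGt (d p : ℕ) (x y : Fin (d / 2) → ℕ) : Prop :=
  List.Lex (· < ·) (restrT d y p) (restrT d x p)

/-- `≥_p` on `{0,…,n}^{d/2} ∪ {⊤}`, where `⊤` (here `none`) is the greatest element. -/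
def sGe (d p : ℕ) : Option (Fin (d / 2) → ℕ) → Option (Fin (d / 2) → ℕ) → Prop
  | none, _ => True
  | some _, none => False
  | some x, some y => tupGe d p x y

/-- `>_p` on `{0,…,n}^{d/2} ∪ {⊤}`: `⊤ >_p x` for every tuple `x`, but not `⊤ >_p ⊤`. -/
def sGt (d p : ℕ) : Option (Fin (d / 2) → ℕ) → Option (Fin (d / 2) → ℕ) → Prop
  | none, none => False
  | none, some _ => True
  | some _, none => False
  | some x, some y => tupGt d p x y

/-- A signature: values are tuples in `{0,…,n}^{d/2}` or `⊤`, and for every vertex `v` of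
priority `p`: if `v` is Eve's there is an edge `(v,v')` with `μ(v) ≥_p μ(v')`, strictly if `p`
is odd; if `v` is Adam's this holds for all edges `(v,v')`. -/
def ParityGame.IsSignature (G : ParityGame) (n : ℕ)
    (μ : G.V → Option (Fin (G.d / 2) → ℕ)) : Prop :=
  (∀ v x, μ v = some x → ∀ j, x j ≤ n) ∧
  (∀ v, v ∈ G.EveV → ∃ v', G.E v v' ∧ sGe G.d (G.c v) (μ v) (μ v') ∧
      (Odd (G.c v) → sGt G.d (G.c v) (μ v) (μ v'))) ∧
  (∀ v, v ∉ G.EveV → ∀ v', G.E v v' → sGe G.d (G.c v) (μ v) (μ v') ∧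
      (Odd (G.c v) → sGt G.d (G.c v) (μ v) (μ v')))

theorem List.Lex.take_eq_or_lex {l₁ l₂ : List ℕ} (h : List.Lex (· < ·) l₁ l₂) (k : ℕ) :
    l₂.take k = l₁.take k ∨ List.Lex (· < ·) (l₁.take k) (l₂.take k) := by
  induction h generalizing k with
  | nil => cases k with
    | zero => exact .inl rfl
    | succ k => exact .inr .nil
  | rel h => cases k with
    | zero => exact .inl rfl
    | succ k => exact .inr (.rel h)
  | cons _ ih => cases k with
    | zero => exact .inl rfl
    | succ k => exact (ih k).imp (fun h => by simp [h]) .cons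

theorem restrT_take {d p q : ℕ} (hqp : q ≤ p) (x : Fin (d / 2) → ℕ) :
    (restrT d x q).take ((d - p + 1) / 2) = restrT d x p := by
  rw [restrT, restrT, List.take_take, min_eq_left (by omega)]

theorem tupGe.mono {d p q : ℕ} (hqp : q ≤ p) {x y : Fin (d / 2) → ℕ} (h : tupGe d q x y) :
    tupGe d p x y := by
  rcases h with h | h
  · exact .inl (by rw [← restrT_take hqp, h, restrT_take hqp])
  · simpa only [tupGe, restrT_take hqp] using h.take_eq_or_lex ((d - p + 1) / 2)

theorem tupGe_iff_le {d p : ℕ} {x y : Fin (d / 2) → ℕ} :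
    tupGe d p x y ↔ restrT d y p ≤ restrT d x p := by
  rw [le_iff_lt_or_eq, or_comm, eq_comm]
  rfl

theorem tupGt_iff_lt {d p : ℕ} {x y : Fin (d / 2) → ℕ} :
    tupGt d p x y ↔ restrT d y p < restrT d x p := Iff.rfl

namespace ParityGame

/-- The edge from `v` to `w` respects the inequality that a signature requires at `v`. -/
def Decreases {G : ParityGame} (μ : G.V → Option (Fin (G.d / 2) → ℕ)) (v w : G.V) : Prop :=
  sGe G.d (G.c v) (μ v) (μ w) ∧ (Odd (G.c v) → sGt G.d (G.c v) (μ v) (μ w))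

/-- A play along which the tuples satisfy the signature inequalities meets the parity objective. -/
theorem satParity_of_tuples (G : ParityGame) (π : ℕ → G.V) (x : ℕ → Fin (G.d / 2) → ℕ)
    (hx : ∀ i j, π i = π j → x i = x j)
    (hge : ∀ i, tupGe G.d (G.c (π i)) (x i) (x (i + 1)))
    (hgt : ∀ i, Odd (G.c (π i)) → tupGt G.d (G.c (π i)) (x i) (x (i + 1))) :
    G.SatParity π := by
  unfold SatParity
  set S := {p | ∀ N, ∃ i, N ≤ i ∧ G.c (π i) = p} with hS
  have hbdd : BddAbove S := by
    refine ⟨G.d, fun p hp => ?_⟩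
    obtain ⟨i, -, rfl⟩ := hp 0
    exact G.c_le_d _
  have hne : S.Nonempty := by
    obtain ⟨w, hw⟩ := Finite.exists_infinite_fiber π
    refine ⟨G.c w, fun N => ?_⟩
    obtain ⟨i, hi, hN⟩ := (Set.infinite_coe_iff.1 hw).exists_gt N
    exact ⟨i, hN.le, congrArg G.c hi⟩
  have hmem := Nat.sSup_mem hne hbdd
  set p := sSup S
  by_contra hodd
  rw [Nat.not_even_iff_odd] at hodd
  have hev : ∀ᶠ i in Filter.atTop, G.c (π i) ≤ p := by
    have : ∀ᶠ i in Filter.atTop, ∀ w : G.V, p < G.c w → π i ≠ w := by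
      refine Filter.eventually_all.2 fun w => ?_
      by_cases hw : p < G.c w
      · have : G.c w ∉ S := fun h => hw.not_ge (le_csSup hbdd h)
        simp only [hS, Set.mem_ofPred_eq, not_forall, not_exists, not_and] at this
        obtain ⟨N, hN⟩ := this
        filter_upwards [Filter.eventually_ge_atTop N] with i hi _ h
        exact hN i hi (congrArg G.c h)
      · exact .of_forall fun i h => absurd h hw
    filter_upwards [this] with i hi
    exact not_lt.1 fun h => hi _ h rfl
  obtain ⟨N, hN⟩ := Filter.eventually_atTop.1 hev
  have hanti : ∀ i j, N ≤ i → i ≤ j → restrT G.d (x j) p ≤ restrT G.d (x i) p := by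
    intro i j hi hij
    induction j, hij using Nat.le_induction with
    | base => exact le_rfl
    | succ j hij ih => exact (tupGe_iff_le.1 ((hge j).mono (hN j (hi.trans hij)))).trans ih
  have hinf : {i | N ≤ i ∧ G.c (π i) = p}.Infinite := by
    refine Set.infinite_of_forall_exists_gt fun a => ?_
    obtain ⟨i, hi, hc⟩ := hmem (max N (a + 1))
    exact ⟨i, ⟨by omega, hc⟩, by omega⟩
  obtain ⟨i, ⟨hi, hci⟩, j, -, hij, hπ⟩ := hinf.exists_lt_map_eq_of_mapsTo
    (Set.mapsTo_univ π _) Set.finite_univ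
  have hlt := hgt i (hci ▸ hodd)
  rw [hci, tupGt_iff_lt] at hlt
  have hle := hanti (i + 1) j (by omega) hij
  rw [← hx i j hπ] at hle
  exact (hle.trans_lt hlt).false

/-- Along a play from a vertex with a non-top value, every step of which respects the signature
inequalities, the parity objective is met. -/
theorem satParity_of_decreases (G : ParityGame) (μ : G.V → Option (Fin (G.d / 2) → ℕ))
    (π : ℕ → G.V) (h0 : μ (π 0) ≠ none) (hdec : ∀ i, Decreases μ (π i) (π (i + 1))) : G.SatParity π := by
  have hsome : ∀ i, ∃ x, μ (π i) = some x := by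
    intro i
    induction i with
    | zero => exact Option.ne_none_iff_exists'.1 h0
    | succ i ih =>
      obtain ⟨x, hx⟩ := ih
      refine Option.ne_none_iff_exists'.1 fun h => ?_
      have hge := (hdec i).1
      rwa [hx, h] at hge
  choose x hx using hsome
  refine G.satParity_of_tuples π x (fun i j h => ?_) (fun i => ?_) fun i hodd => ?_
  · exact Option.some_injective _ (by rw [← hx, ← hx, h])
  · simpa only [hx, sGe] using (hdec i).1
  · simpa only [hx, sGt] using (hdec i).2 hodd

end ParityGame

/-- Let `G` be a parity game with `n` vertices and `d` priorities.
If `μ : V → {0,…,n}^{d/2} ∪ {⊤}` is a signature and `v ∈ V` satisfies `μ(v) ≠ ⊤`,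
then Eve wins from `v`. -/
theorem signature_implies_win (G : ParityGame) (hd : Even G.d)
    (μ : G.V → Option (Fin (G.d / 2) → ℕ))
    (hμ : G.IsSignature (Fintype.card G.V) μ)
    (v : G.V) (hv : μ v ≠ none) :
    G.EveWinsFrom v := by
  obtain ⟨-, hE, hA⟩ := hμ
  choose! next hnext hdec using hE
  refine ⟨⟨fun _ w => next w, fun _ w hw => hnext w hw⟩, fun π hπ hcons => ?_⟩
  refine G.satParity_of_decreases μ π (hπ.1 ▸ hv) fun i => ?_
  by_cases hi : π i ∈ G.EveV
  · rw [hcons i hi]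
    exact hdec _ hi
  · exact hA _ hi _ (hπ.2 i)
end

section
/- Let G be a parity game with priorities in {1,…,p} where p is even, let V_p be its set of vertices of priority p, and let Win, Lose ⊆ V be disjoint sets with V_p ∩ (Win ∪ Lose) = ∅. Then W_E(O(Win, Lose)) is the greatest fixed point of the monotone operator on subsets of V given by Y ↦ W_E(O(Win ∪ (V_p ∩ Pre(Y)), Lose ∪ (V_p ∖ Pre(Y)))). -/
namespace ParityGame

variable (G : ParityGame)

/-- The objective `O(W, L)` for disjoint `W, L`: either reach `W` without having visited `L`
before, or never visit `W ∪ L` and satisfy the parity objective. -/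
def Obj (W L : Set G.V) (π : ℕ → G.V) : Prop :=
  (∃ i, π i ∈ W ∧ ∀ j < i, π j ∉ L) ∨ ((∀ i, π i ∉ W ∪ L) ∧ G.SatParity π)

/-- Eve's winning region for an objective `Ω`. -/
def WinRegion (Ω : (ℕ → G.V) → Prop) : Set G.V :=
  {v0 | G.EveWinsObj Ω v0}

/-- `Pre(Y)`: the vertices from which Eve can ensure to reach `Y` in one step. -/
def Pre (Y : Set G.V) : Set G.V :=
  {u | (u ∈ G.EveV ∧ ∃ v, G.E u v ∧ v ∈ Y) ∨ (u ∉ G.EveV ∧ ∀ v, G.E u v → v ∈ Y)}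

end ParityGame

namespace ParityGame

variable {G : ParityGame}

theorem satParity_shift (π : ℕ → G.V) (n : ℕ) :
    G.SatParity (fun i => π (n + i)) ↔ G.SatParity π := by
  have h : {p | ∀ N, ∃ i, N ≤ i ∧ G.c (π (n + i)) = p} =
      {p | ∀ N, ∃ i, N ≤ i ∧ G.c (π i) = p} := by
    ext p
    constructor
    · intro h N
      obtain ⟨i, hi, hc⟩ := h N
      exact ⟨n + i, by omega, hc⟩
    · intro h N
      obtain ⟨i, hi, hc⟩ := h (n + N)
      exact ⟨i - n, by omega, by rwa [Nat.add_sub_cancel' (by omega)]⟩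
  unfold SatParity
  rw [h]

theorem satParity_of_frequently_max (hd : Even G.d) {π : ℕ → G.V}
    (h : ∀ N, ∃ i, N ≤ i ∧ G.c (π i) = G.d) : G.SatParity π := by
  have hmax : IsGreatest {p | ∀ N, ∃ i, N ≤ i ∧ G.c (π i) = p} G.d := by
    refine ⟨h, fun p hp => ?_⟩
    obtain ⟨i, -, rfl⟩ := hp 0
    exact G.c_le_d _
  unfold SatParity
  rwa [hmax.csSup_eq]

theorem obj_shift {W L : Set G.V} {π : ℕ → G.V} {n : ℕ} (h : ∀ j < n, π j ∉ W ∪ L) :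
    G.Obj W L (fun i => π (n + i)) ↔ G.Obj W L π := by
  unfold Obj
  rw [satParity_shift]
  refine or_congr ⟨?_, ?_⟩ (and_congr_left fun _ => ⟨?_, fun H i => H _⟩)
  · rintro ⟨i, hi, hL⟩
    refine ⟨n + i, hi, fun j hj hjL => ?_⟩
    rcases lt_or_ge j n with hjn | hjn
    · exact h j hjn (Or.inr hjL)
    · refine hL (j - n) (by omega) ?_
      simpa only [Nat.add_sub_cancel' hjn] using hjL
  · rintro ⟨i, hi, hL⟩
    have hn : n ≤ i := by
      by_contra hlt
      exact h i (by omega) (Or.inl hi)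
    exact ⟨i - n, by simpa only [Nat.add_sub_cancel' hn] using hi, fun j hj => hL _ (by omega)⟩
  · intro H i
    rcases lt_or_ge i n with hin | hin
    · exact h i hin
    · simpa [Nat.add_sub_cancel' hin] using H (i - n)

instance : Nonempty (EveStrategy G) :=
  ⟨⟨fun _ v => (G.exists_succ v).choose, fun _ v _ => (G.exists_succ v).choose_spec⟩⟩

/-- The strategy that plays like `σ` after the history `l`. -/
def EveStrategy.residual (σ : EveStrategy G) (l : List G.V) : EveStrategy G where
  move l' v := σ.move (l ++ l') v
  follows _ v hv := σ.follows _ v hv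

theorem exists_consistent_play (σ : EveStrategy G) (v : G.V) :
    ∃ π, G.IsPlay v π ∧ G.ConsistentE σ π := by
  classical
  let next : List G.V → G.V → G.V := fun l u =>
    if u ∈ G.EveV then σ.move l u else (G.exists_succ u).choose
  let S : ℕ → List G.V × G.V := fun n =>
    Nat.rec ([], v) (fun _ s => (s.1 ++ [s.2], next s.1 s.2)) n
  have hl : ∀ n, (List.range n).map (fun i => (S i).2) = (S n).1 := by
    intro n
    induction n with
    | zero => rfl
    | succ n ih => rw [List.range_succ, List.map_append, ih]; rfl
  have hS : ∀ n, (S (n + 1)).2 = next (S n).1 (S n).2 := fun n => rfl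
  refine ⟨fun i => (S i).2, ⟨rfl, fun i => ?_⟩, fun i hi => ?_⟩
  · simp only [hS, next]
    split_ifs with h
    · exact σ.follows _ _ h
    · exact (G.exists_succ _).choose_spec
  · simp only [hS, next]
    rw [if_pos hi, hl]

/-- The sequence following `π` for the first `n` vertices and `ρ` from then on. -/
def splice (π : ℕ → G.V) (n : ℕ) (ρ : ℕ → G.V) (i : ℕ) : G.V :=
  if i < n then π i else ρ (i - n)

theorem splice_of_lt (π ρ : ℕ → G.V) {n i : ℕ} (h : i < n) : splice π n ρ i = π i := if_pos h

theorem splice_add (π ρ : ℕ → G.V) (n i : ℕ) : splice π n ρ (n + i) = ρ i := by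
  simp [splice]

theorem splice_of_le {π ρ : ℕ → G.V} {n i : ℕ} (h0 : ρ 0 = π n) (h : i ≤ n) :
    splice π n ρ i = π i := by
  rcases h.lt_or_eq with h | rfl
  · exact splice_of_lt π ρ h
  · rw [← h0]; exact splice_add π ρ i 0

theorem map_range_congr {α : Type*} {f g : ℕ → α} {n : ℕ} (h : ∀ i < n, f i = g i) :
    (List.range n).map f = (List.range n).map g :=
  List.map_congr_left fun i hi => h i (List.mem_range.1 hi)

theorem splice_consistent {σ : EveStrategy G} {π ρ : ℕ → G.V} {n : ℕ}
    (hE : ∀ i < n, G.E (π i) (π (i + 1)))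
    (hσ : ∀ i < n, π i ∈ G.EveV → π (i + 1) = σ.move ((List.range i).map π) (π i))
    (hρ : G.IsPlay (π n) ρ) (hρσ : G.ConsistentE (σ.residual ((List.range n).map π)) ρ) :
    G.IsPlay (π 0) (splice π n ρ) ∧ G.ConsistentE σ (splice π n ρ) := by
  have hle : ∀ {i}, i ≤ n → splice π n ρ i = π i := splice_of_le hρ.1
  refine ⟨⟨hle (Nat.zero_le n), fun i => ?_⟩, fun i hi => ?_⟩
  · rcases lt_or_ge i n with h | h
    · rw [hle h.le, hle h]
      exact hE i h
    · obtain ⟨j, rfl⟩ := Nat.exists_eq_add_of_le h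
      rw [add_assoc, splice_add, splice_add]
      exact hρ.2 j
  · rcases lt_or_ge i n with h | h
    · rw [map_range_congr fun j hj => hle (hj.trans h).le]
      rw [hle h.le] at hi ⊢
      rw [hle h]
      exact hσ i h hi
    · obtain ⟨j, rfl⟩ := Nat.exists_eq_add_of_le h
      rw [splice_add] at hi
      have hl : (List.range (n + j)).map (splice π n ρ) =
          (List.range n).map π ++ (List.range j).map ρ := by
        rw [List.range_add, List.map_append, map_range_congr fun i hi => hle hi.le,
          List.map_map]
        congr 1
        exact map_range_congr fun i _ => splice_add π ρ n i
      rw [hl, add_assoc, splice_add, splice_add]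
      exact hρσ j hi

theorem exists_consistent_extension {σ : EveStrategy G} {π : ℕ → G.V} {n : ℕ}
    (hE : ∀ i < n, G.E (π i) (π (i + 1)))
    (hσ : ∀ i < n, π i ∈ G.EveV → π (i + 1) = σ.move ((List.range i).map π) (π i)) :
    ∃ ρ, G.IsPlay (π 0) ρ ∧ G.ConsistentE σ ρ ∧ ∀ i ≤ n, ρ i = π i := by
  obtain ⟨ρ, hρ, hρσ⟩ :=
    exists_consistent_play (σ.residual ((List.range n).map π)) (π n)
  obtain ⟨h₁, h₂⟩ := splice_consistent hE hσ hρ hρσ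
  exact ⟨_, h₁, h₂, fun i hi => splice_of_le hρ.1 hi⟩

/-- Along a play that has not yet visited `W ∪ L`, a winning strategy for `O(W, L)` only
allows moves to winning vertices. -/
theorem mem_winRegion_of_consistent_move {W L : Set G.V} {v : G.V} {σ : EveStrategy G}
    (hwin : ∀ π, G.IsPlay v π → G.ConsistentE σ π → G.Obj W L π) {π : ℕ → G.V}
    (hπ : G.IsPlay v π) (hπσ : G.ConsistentE σ π) {k : ℕ} (hk : ∀ j ≤ k, π j ∉ W ∪ L)
    {w : G.V} (hw : G.E (π k) w)
    (hmove : π k ∈ G.EveV → w = σ.move ((List.range k).map π) (π k)) :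
    w ∈ G.WinRegion (G.Obj W L) := by
  let π' := Function.update π (k + 1) w
  have hlt : ∀ {i}, i < k + 1 → π' i = π i := fun h => Function.update_of_ne h.ne _ _
  have hlast : π' (k + 1) = w := Function.update_self _ _ _
  refine ⟨σ.residual ((List.range (k + 1)).map π'), fun ρ hρ hρσ => ?_⟩
  have hE : ∀ i < k + 1, G.E (π' i) (π' (i + 1)) := by
    intro i hi
    rw [hlt hi]
    rcases (Nat.lt_succ_iff.1 hi).lt_or_eq with h | rfl
    · rw [hlt (by omega)]
      exact hπ.2 i
    · rwa [hlast]
  have hσ : ∀ i < k + 1, π' i ∈ G.EveV →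
      π' (i + 1) = σ.move ((List.range i).map π') (π' i) := by
    intro i hi hiE
    rw [map_range_congr fun j hj => hlt (hj.trans hi)]
    rw [hlt hi] at hiE ⊢
    rcases (Nat.lt_succ_iff.1 hi).lt_or_eq with h | rfl
    · rw [hlt (by omega)]
      exact hπσ i hiE
    · rw [hlast]
      exact hmove hiE
  obtain ⟨h₁, h₂⟩ := splice_consistent hE hσ (hlast.symm ▸ hρ) hρσ
  rw [hlt (Nat.succ_pos k), hπ.1] at h₁
  have hobj := (obj_shift (n := k + 1) fun j hj => by
    rw [splice_of_lt _ _ hj, hlt hj]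
    exact hk j (Nat.lt_succ_iff.1 hj)).2 (hwin _ h₁ h₂)
  simpa only [splice_add] using hobj

theorem WinRegion.mono {Ω Ω' : (ℕ → G.V) → Prop} (h : ∀ π, Ω π → Ω' π) :
    G.WinRegion Ω ⊆ G.WinRegion Ω' := by
  rintro v ⟨σ, hσ⟩
  exact ⟨σ, fun π hπ hπσ => h π (hσ π hπ hπσ)⟩

theorem Pre.mono {Y Z : Set G.V} (h : Y ⊆ Z) : G.Pre Y ⊆ G.Pre Z := by
  rintro u (⟨hu, v, hv, hY⟩ | ⟨hu, hY⟩)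
  · exact Or.inl ⟨hu, v, hv, h hY⟩
  · exact Or.inr ⟨hu, fun v hv => h (hY v hv)⟩

theorem winRegion_pre_mono {W L P Y Z : Set G.V} (h : Y ⊆ Z) :
    G.WinRegion (G.Obj (W ∪ (P ∩ G.Pre Y)) (L ∪ (P \ G.Pre Y))) ⊆
      G.WinRegion (G.Obj (W ∪ (P ∩ G.Pre Z)) (L ∪ (P \ G.Pre Z))) := by
  have hpre := Pre.mono h
  refine WinRegion.mono fun π => ?_
  rintro (⟨i, hi, hL⟩ | ⟨h, hpar⟩)
  · refine Or.inl ⟨i, Set.union_subset_union_right _ (Set.inter_subset_inter_right _ hpre) hi,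
      fun j hj hjL => hL j hj ?_⟩
    exact Set.union_subset_union_right _ (Set.sdiff_subset_sdiff_right hpre) hjL
  · refine Or.inr ⟨fun i hi => h i ?_, hpar⟩
    simp only [Set.mem_union, Set.mem_inter_iff, Set.mem_sdiff] at hi ⊢
    tauto

theorem winRegion_subset_winRegion_pre {W L P : Set G.V} (hWL : Disjoint W L)
    (hP : P ∩ (W ∪ L) = ∅) :
    G.WinRegion (G.Obj W L) ⊆
      G.WinRegion (G.Obj (W ∪ (P ∩ G.Pre (G.WinRegion (G.Obj W L))))
        (L ∪ (P \ G.Pre (G.WinRegion (G.Obj W L))))) := by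
  classical
  rintro v ⟨σ, hσ⟩
  refine ⟨σ, fun π hπ hπσ => ?_⟩
  by_cases hex : ∃ i, π i ∈ W ∪ L ∪ P
  swap
  · push Not at hex
    rcases hσ π hπ hπσ with ⟨i, hi, -⟩ | ⟨-, hpar⟩
    · exact absurd (Or.inl (Or.inl hi)) (hex i)
    · refine Or.inr ⟨fun i hi => hex i ?_, hpar⟩
      simp only [Set.mem_union, Set.mem_inter_iff, Set.mem_sdiff] at hi ⊢
      tauto
  have hmin : ∀ j < Nat.find hex, π j ∉ W ∪ L ∪ P := fun j hj => Nat.find_min hex hj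
  have hspec := Nat.find_spec hex
  generalize Nat.find hex = k at hmin hspec
  refine Or.inl ⟨k, ?_, fun j hj hjL => hmin j hj ?_⟩
  swap
  · simp only [Set.mem_union, Set.mem_sdiff] at hjL ⊢
    tauto
  rcases hspec with (hkW | hkL) | hkP
  · exact Or.inl hkW
  · exfalso
    rcases hσ π hπ hπσ with ⟨i, hi, hL⟩ | ⟨h, -⟩
    · rcases lt_trichotomy i k with h | rfl | h
      · exact hmin i h (Or.inl (Or.inl hi))
      · exact Set.disjoint_left.1 hWL hi hkL
      · exact hL k h hkL
    · exact h k (Or.inr hkL)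
  · have hk : ∀ j ≤ k, π j ∉ W ∪ L := by
      intro j hj hjWL
      rcases hj.lt_or_eq with hj | rfl
      · exact hmin j hj (Or.inl hjWL)
      · exact Set.eq_empty_iff_forall_notMem.1 hP _ ⟨hkP, hjWL⟩
    refine Or.inr ⟨hkP, ?_⟩
    by_cases hE : π k ∈ G.EveV
    · exact Or.inl ⟨hE, _, σ.follows _ _ hE,
        mem_winRegion_of_consistent_move hσ hπ hπσ hk (σ.follows _ _ hE) fun _ => rfl⟩
    · exact Or.inr ⟨hE, fun w hw =>
        mem_winRegion_of_consistent_move hσ hπ hπσ hk hw fun h => absurd h hE⟩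

open Classical in
/-- The part of a history since the last visit to `P`. -/
noncomputable def sinceLast (P : Set G.V) (l : List G.V) : List G.V :=
  l.foldl (fun m u => if u ∈ P then [] else m ++ [u]) []

theorem sinceLast_map_range_succ (P : Set G.V) (π : ℕ → G.V) (n : ℕ) [Decidable (π n ∈ P)] :
    sinceLast P ((List.range (n + 1)).map π) =
      if π n ∈ P then [] else sinceLast P ((List.range n).map π) ++ [π n] := by
  simp [sinceLast, List.range_succ]

theorem sinceLast_map_range_add {P : Set G.V} {π : ℕ → G.V} {k : ℕ}
    (hk : sinceLast P ((List.range k).map π) = []) (n : ℕ) (hn : ∀ j < n, π (k + j) ∉ P) :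
    sinceLast P ((List.range (k + n)).map π) = (List.range n).map fun j => π (k + j) := by
  classical
  induction n with
  | zero => exact hk
  | succ n ih =>
    rw [← add_assoc, sinceLast_map_range_succ, if_neg (hn n n.lt_succ_self),
      ih fun j hj => hn j (hj.trans n.lt_succ_self), List.range_succ, List.map_append]
    rfl

open Classical in
/-- From a vertex `s`, play the strategy `σ s` until a vertex of `P` is visited; there, move to
`Y` if possible, and start again from the vertex reached. -/
noncomputable def restart (P Y : Set G.V) (σ : G.V → EveStrategy G) : EveStrategy G where
  move l v :=
    if h : v ∈ P ∧ ∃ w, G.E v w ∧ w ∈ Y then h.2.choose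
    else (σ ((sinceLast P l).headD v)).move (sinceLast P l) v
  follows l v hv := by
    split_ifs with h
    · exact h.2.choose_spec.1
    · exact (σ _).follows _ _ hv

theorem restart_move_mem {P Y : Set G.V} (σ : G.V → EveStrategy G) (l : List G.V) {v : G.V}
    (hv : v ∈ P) (h : ∃ w, G.E v w ∧ w ∈ Y) : (restart P Y σ).move l v ∈ Y := by
  have h' : v ∈ P ∧ ∃ w, G.E v w ∧ w ∈ Y := ⟨hv, h⟩
  simp only [restart, dif_pos h']
  exact h'.2.choose_spec.2

theorem restart_move_of_notMem {P Y : Set G.V} (σ : G.V → EveStrategy G) (l : List G.V) {v : G.V}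
    (hv : v ∉ P) : (restart P Y σ).move l v =
      (σ ((sinceLast P l).headD v)).move (sinceLast P l) v :=
  dif_neg fun h => hv h.1

theorem headD_map_range {α : Type*} (f : ℕ → α) (n : ℕ) :
    ((List.range n).map f).headD (f n) = f 0 := by
  cases n with
  | zero => rfl
  | succ n => simp [List.range_succ_eq_map]

theorem restart_consistent {P Y : Set G.V} {σ : G.V → EveStrategy G} {π : ℕ → G.V}
    (hπ : G.ConsistentE (restart P Y σ) π) {k : ℕ}
    (hk : sinceLast P ((List.range k).map π) = []) {n : ℕ} (hn : ∀ j ≤ n, π (k + j) ∉ P)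
    (hE : π (k + n) ∈ G.EveV) :
    π (k + (n + 1)) =
      (σ (π k)).move ((List.range n).map fun j => π (k + j)) (π (k + n)) := by
  have h := hπ (k + n) hE
  rw [restart_move_of_notMem _ _ (hn n le_rfl),
    sinceLast_map_range_add hk n fun j hj => hn j hj.le,
    headD_map_range (fun j => π (k + j))] at h
  exact h

theorem subset_winRegion_of_subset_winRegion_pre (hd : Even G.d) {W L Y : Set G.V}
    (hP : {v : G.V | G.c v = G.d} ∩ (W ∪ L) = ∅)
    (hY : Y ⊆ G.WinRegion (G.Obj (W ∪ ({v : G.V | G.c v = G.d} ∩ G.Pre Y))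
      (L ∪ ({v : G.V | G.c v = G.d} \ G.Pre Y)))) :
    Y ⊆ G.WinRegion (G.Obj W L) := by
  classical
  have hmax : ∀ u, u ∈ {v : G.V | G.c v = G.d} → G.c u = G.d := fun _ h => h
  generalize {v : G.V | G.c v = G.d} = P at hP hY hmax
  have hPWL : ∀ u ∈ P, u ∉ W ∪ L := fun u hu hu' =>
    Set.eq_empty_iff_forall_notMem.1 hP u ⟨hu, hu'⟩
  have hσ : ∀ v, ∃ σ : EveStrategy G, v ∈ Y → ∀ π, G.IsPlay v π → G.ConsistentE σ π →
      G.Obj (W ∪ (P ∩ G.Pre Y)) (L ∪ (P \ G.Pre Y)) π := by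
    intro v
    by_cases hv : v ∈ Y
    · obtain ⟨σ, h⟩ := hY hv
      exact ⟨σ, fun _ => h⟩
    · exact ⟨Classical.arbitrary _, fun h => absurd h hv⟩
  choose σ hσ using hσ
  intro v hv
  refine ⟨restart P Y σ, fun π hπ hπσ => ?_⟩
  by_contra hobj
  have hW : ∀ i, π i ∈ W → ∃ j < i, π j ∈ L := by
    intro i hi
    by_contra! h
    exact hobj (Or.inl ⟨i, hi, h⟩)
  let Fresh : ℕ → Prop := fun k =>
    sinceLast P ((List.range k).map π) = [] ∧ π k ∈ Y ∧ ∀ j < k, π j ∉ L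
  have hstep : ∀ k, Fresh k → ∃ n, π (k + n) ∈ P ∧ Fresh (k + n + 1) := by
    rintro k ⟨hk, hkY, hkL⟩
    have hkWL : ∀ j < k, π j ∉ W ∪ L := by
      rintro j hj (hjW | hjL)
      · obtain ⟨i, hi, hiL⟩ := hW j hjW
        exact hkL i (hi.trans hj) hiL
      · exact hkL j hj hjL
    by_cases hex : ∃ n, π (k + n) ∈ P
    swap
    · push Not at hex
      exfalso
      refine hobj ((obj_shift hkWL).1 ?_)
      rcases hσ (π k) hkY (fun i => π (k + i)) ⟨rfl, fun i => hπ.2 (k + i)⟩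
        (fun n hn => restart_consistent hπσ hk (fun j _ => hex j) hn) with
        ⟨i, hi, hL⟩ | ⟨h, hpar⟩
      · exact Or.inl ⟨i, hi.resolve_right fun h => hex i h.1,
          fun j hj hjL => hL j hj (Or.inl hjL)⟩
      · exact Or.inr ⟨fun i hi => h i (hi.imp Or.inl Or.inl), hpar⟩
    have hmin : ∀ j < Nat.find hex, π (k + j) ∉ P := fun j hj => Nat.find_min hex hj
    have hnP := Nat.find_spec hex
    generalize Nat.find hex = n at hmin hnP
    obtain ⟨ρ, hρ, hρσ, hρπ⟩ := exists_consistent_extension (σ := σ (π k))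
      (π := fun i => π (k + i)) (n := n) (fun i _ => hπ.2 (k + i))
      (fun i hi hiE => restart_consistent hπσ hk (fun j hj => hmin j (by omega)) hiE)
    have hpre : π (k + n) ∈ G.Pre Y ∧ ∀ j < n, π (k + j) ∉ L := by
      rcases hσ (π k) hkY ρ hρ hρσ with ⟨i, hi, hL⟩ | ⟨h, -⟩
      · rcases lt_or_ge i n with hin | hin
        · exfalso
          rw [hρπ i hin.le] at hi
          refine hobj ((obj_shift hkWL).1 (Or.inl ⟨i, hi.resolve_right fun h => hmin i hin h.1,
            fun j hj hjL => hL j hj (Or.inl ?_)⟩))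
          rwa [hρπ j (hj.trans hin).le]
        · refine ⟨?_, fun j hj hjL => hL j (by omega) (Or.inl ?_)⟩
          · rcases hin.lt_or_eq with h | rfl
            · by_contra hnot
              refine hL n h (Or.inr ?_)
              rw [hρπ n le_rfl]
              exact ⟨hnP, hnot⟩
            · rw [hρπ n le_rfl] at hi
              exact (hi.resolve_left fun h => hPWL _ hnP (Or.inl h)).2
          · rwa [hρπ j hj.le]
      · exfalso
        apply h n
        rw [hρπ n le_rfl]
        by_cases hn : π (k + n) ∈ G.Pre Y
        · exact Or.inl (Or.inr ⟨hnP, hn⟩)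
        · exact Or.inr (Or.inr ⟨hnP, hn⟩)
    refine ⟨n, hnP, by rw [sinceLast_map_range_succ, if_pos hnP], ?_, fun j hj hjL => ?_⟩
    · rcases hpre.1 with ⟨hE, h⟩ | ⟨-, h⟩
      · rw [hπσ (k + n) hE]
        exact restart_move_mem σ _ hnP h
      · exact h _ (hπ.2 _)
    · rcases lt_or_ge j k with hjk | hjk
      · exact hkL j hjk hjL
      · obtain ⟨i, rfl⟩ := Nat.exists_eq_add_of_le hjk
        rcases (show i ≤ n by omega).lt_or_eq with hi | rfl
        · exact hpre.2 i hi hjL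
        · exact hPWL _ hnP (Or.inr hjL)
  have hfresh : ∀ N, ∃ k, N ≤ k ∧ Fresh k := by
    intro N
    induction N with
    | zero => exact ⟨0, le_rfl, rfl, hπ.1 ▸ hv, fun j hj => absurd hj (Nat.not_lt_zero j)⟩
    | succ N ih =>
      obtain ⟨k, hNk, hk⟩ := ih
      obtain ⟨n, -, hn⟩ := hstep k hk
      exact ⟨_, by omega, hn⟩
  have hL : ∀ i, π i ∉ L := by
    intro i
    obtain ⟨k, hik, hk⟩ := hfresh (i + 1)
    exact hk.2.2 i hik
  refine hobj (Or.inr ⟨?_, satParity_of_frequently_max hd fun N => ?_⟩)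
  · rintro i (hi | hi)
    · obtain ⟨j, -, hj⟩ := hW i hi
      exact hL j hj
    · exact hL i hi
  · obtain ⟨k, hNk, hk⟩ := hfresh N
    obtain ⟨n, hn, -⟩ := hstep k hk
    exact ⟨k + n, by omega, hmax _ hn⟩

end ParityGame

/-- Let `G` be a parity game with priorities in `{1,…,p}` with `p` even, `V_p`
its set of vertices of priority `p`, and `Win, Lose ⊆ V` disjoint sets with
`V_p ∩ (Win ∪ Lose) = ∅`. Then `W_E(O(Win, Lose))` is the greatest fixed point of
`Y ↦ W_E(O(Win ∪ (V_p ∩ Pre(Y)), Lose ∪ (V_p ∖ Pre(Y))))`. -/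
theorem winRegion_greatest_fixed_point (G : ParityGame) (hp : Even G.d)
    (Win Lose : Set G.V) (hdisj : Disjoint Win Lose)
    (hsep : {v : G.V | G.c v = G.d} ∩ (Win ∪ Lose) = ∅) :
    (G.WinRegion (G.Obj
        (Win ∪ ({v : G.V | G.c v = G.d} ∩ G.Pre (G.WinRegion (G.Obj Win Lose))))
        (Lose ∪ ({v : G.V | G.c v = G.d} \ G.Pre (G.WinRegion (G.Obj Win Lose)))))
      = G.WinRegion (G.Obj Win Lose)) ∧
    ∀ Y : Set G.V,
      G.WinRegion (G.Obj (Win ∪ ({v : G.V | G.c v = G.d} ∩ G.Pre Y))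
          (Lose ∪ ({v : G.V | G.c v = G.d} \ G.Pre Y))) = Y →
      Y ⊆ G.WinRegion (G.Obj Win Lose) := by
  have hsub := ParityGame.winRegion_subset_winRegion_pre hdisj hsep
  exact ⟨(ParityGame.subset_winRegion_of_subset_winRegion_pre hp hsep
    (ParityGame.winRegion_pre_mono hsub)).antisymm hsub,
    fun Y hY => ParityGame.subset_winRegion_of_subset_winRegion_pre hp hsep hY.ge⟩
end

section
/- Parity games are positionally determined for Eve: for every parity game there exists a positional strategy σ : V_E → V for Eve that is winning from every vertex from which Eve wins, i.e., for every v ∈ V, if Eve wins from v then every play from v consistent with σ satisfies the parity objective. -/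
namespace ParityGame

/-- Player `b` wins the infinite sequence `π` when the largest priority seen infinitely often
is even (`b = true`) or odd (`b = false`). -/
def Wins {V : Type*} (c : V → ℕ) (b : Bool) (π : ℕ → V) : Prop :=
  ∃ p, decide (Even p) = b ∧ (∀ N, ∃ i, N ≤ i ∧ c (π i) = p) ∧ ∃ N, ∀ i, N ≤ i → c (π i) ≤ p

theorem Wins.of_shift {V : Type*} {c : V → ℕ} {b : Bool} {π : ℕ → V} (k : ℕ)
    (h : Wins c b fun i => π (k + i)) : Wins c b π := by
  obtain ⟨p, hp, hinf, N, hN⟩ := h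
  refine ⟨p, hp, fun M => ?_, k + N, fun i hi => ?_⟩
  · obtain ⟨i, hi, hc⟩ := hinf M
    exact ⟨k + i, by omega, hc⟩
  · have := hN (i - k) (by omega)
    simpa only [show k + (i - k) = i by omega] using this

theorem Wins.unique {V : Type*} {c : V → ℕ} {b b' : Bool} {π : ℕ → V}
    (h : Wins c b π) (h' : Wins c b' π) : b = b' := by
  obtain ⟨p, rfl, hinf, N, hN⟩ := h
  obtain ⟨q, rfl, hinf', N', hN'⟩ := h'
  obtain ⟨i, hi, rfl⟩ := hinf N'
  obtain ⟨j, hj, rfl⟩ := hinf' N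
  rw [le_antisymm (hN' i hi) (hN j hj)]

theorem satParity_iff_wins (G : ParityGame) (π : ℕ → G.V) (b : Bool) (h : Wins G.c b π) :
    G.SatParity π ↔ b = true := by
  obtain ⟨p, rfl, hinf, N, hN⟩ := h
  have : IsGreatest {p | ∀ N, ∃ i, N ≤ i ∧ G.c (π i) = p} p := by
    refine ⟨hinf, fun q hq => ?_⟩
    obtain ⟨i, hi, rfl⟩ := hq N
    exact hN i hi
  rw [SatParity, this.csSup_eq, decide_eq_true_iff]

/-- A finite set `T` inside an arena `S` has an attractor `X` for player `b`, with an attracting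
positional strategy `σ` that decreases a rank, and whose complement is a trap for `b`. -/
theorem exists_attractor {V : Type*} (E : V → V → Prop) (own : V → Bool) (b : Bool)
    (S T : Finset V) (hT : T ⊆ S) :
    ∃ (X : Finset V) (r : V → ℕ) (σ : V → V), T ⊆ X ∧ X ⊆ S ∧
      (∀ v ∈ X, v ∉ T →
        (own v = b → E v (σ v) ∧ σ v ∈ X ∧ r (σ v) < r v) ∧
        (own v ≠ b → ∀ w ∈ S, E v w → w ∈ X ∧ r w < r v)) ∧
      (∀ v ∈ S, v ∉ X →
        (own v = b → ∀ w ∈ X, ¬ E v w) ∧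
        (own v ≠ b → ∃ w ∈ S, w ∉ X ∧ E v w)) := by
  classical
  let Q : Finset V → Prop := fun X => ∃ (r : V → ℕ) (σ : V → V), T ⊆ X ∧ X ⊆ S ∧
      (∀ v ∈ X, v ∉ T →
        (own v = b → E v (σ v) ∧ σ v ∈ X ∧ r (σ v) < r v) ∧
        (own v ≠ b → ∀ w ∈ S, E v w → w ∈ X ∧ r w < r v))
  have hQ : (S.powerset.filter Q).Nonempty :=
    ⟨T, by
      simp only [Finset.mem_filter, Finset.mem_powerset]
      exact ⟨hT, fun _ => 0, id, subset_rfl, hT, fun v hv hv' => absurd hv hv'⟩⟩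
  obtain ⟨X, hX, hmax⟩ := Finset.exists_max_image _ Finset.card hQ
  obtain ⟨r, σ, hTX, hXS, hr⟩ := (Finset.mem_filter.1 hX).2
  refine ⟨X, r, σ, hTX, hXS, hr, fun v hv hvX => ?_⟩
  by_contra hcon
  have hext : ∃ u, (own v = b → u ∈ X ∧ E v u) ∧ (own v ≠ b → ∀ w ∈ S, E v w → w ∈ X) := by
    by_cases hb : own v = b
    · simp only [hb, ne_eq, not_true_eq_false, false_imp_iff, and_true, true_imp_iff] at hcon ⊢
      push Not at hcon
      exact hcon
    · refine ⟨v, fun h => absurd h hb, fun _ w hw hE => ?_⟩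
      by_contra hwX
      exact hcon ⟨fun h => absurd h hb, fun _ => ⟨w, hw, hwX, hE⟩⟩
  obtain ⟨u, hu, hall⟩ := hext
  have hne : ∀ w ∈ X, w ≠ v := fun w hw h => hvX (h ▸ hw)
  have hlt : ∀ w ∈ X, r w < X.sup r + 1 := fun w hw => Nat.lt_succ_of_le (Finset.le_sup hw)
  have hins : Q (insert v X) := by
    refine ⟨Function.update r v (X.sup r + 1), Function.update σ v u,
      hTX.trans (Finset.subset_insert _ _), Finset.insert_subset hv hXS, fun w hw hwT => ?_⟩
    rcases Finset.mem_insert.1 hw with rfl | hwX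
    · refine ⟨fun hb => ?_, fun hb x hx hE => ?_⟩
      · obtain ⟨huX, hE⟩ := hu hb
        simpa [Function.update_of_ne (hne u huX), huX, hE] using hlt u huX
      · have hxX := hall hb x hx hE
        simpa [Function.update_of_ne (hne x hxX), hxX] using hlt x hxX
    · obtain ⟨h1, h2⟩ := hr w hwX hwT
      rw [Function.update_of_ne (hne w hwX), Function.update_of_ne (hne w hwX)]
      refine ⟨fun hb => ?_, fun hb x hx hE => ?_⟩
      · obtain ⟨hE, hX', hlt'⟩ := h1 hb
        rw [Function.update_of_ne (hne _ hX')]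
        exact ⟨hE, Finset.mem_insert_of_mem hX', hlt'⟩
      · obtain ⟨hX', hlt'⟩ := h2 hb x hx hE
        rw [Function.update_of_ne (hne _ hX')]
        exact ⟨Finset.mem_insert_of_mem hX', hlt'⟩
  have := hmax (insert v X) (Finset.mem_filter.2
    ⟨Finset.mem_powerset.2 (Finset.insert_subset hv hXS), hins⟩)
  rw [Finset.card_insert_of_notMem hvX] at this
  omega

/-- A path that stays in `X` with decreasing rank until it meets `T` eventually meets `T`. -/
theorem exists_mem_of_rank_lt {V : Type*} {X T : Finset V} {r : V → ℕ} {π : ℕ → V}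
    (h : ∀ i, π i ∈ X → π i ∉ T → π (i + 1) ∈ X ∧ r (π (i + 1)) < r (π i)) (k : ℕ)
    (hk : π k ∈ X) : ∃ j, k ≤ j ∧ π j ∈ T := by
  induction hn : r (π k) using Nat.strong_induction_on generalizing k with
  | _ n ih =>
    by_cases hT : π k ∈ T
    · exact ⟨k, le_rfl, hT⟩
    · obtain ⟨h1, h2⟩ := h k hk hT
      obtain ⟨j, hj, hjT⟩ := ih _ (hn ▸ h2) (k + 1) h1 rfl
      exact ⟨j, by omega, hjT⟩

/-- `side` splits the arena `S` into two regions, closed for the respective opponent, on which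
the positional strategy `σ` is winning for the respective player. -/
structure IsSolution {V : Type*} (E : V → V → Prop) (own : V → Bool) (c : V → ℕ) (S : Finset V)
    (side : V → Bool) (σ : V → V) : Prop where
  move : ∀ v ∈ S, own v = side v → E v (σ v) ∧ σ v ∈ S ∧ side (σ v) = side v
  closed : ∀ v ∈ S, own v ≠ side v → ∀ w ∈ S, E v w → side w = side v
  wins : ∀ (b : Bool) (π : ℕ → V),
    (∀ i, π i ∈ S ∧ side (π i) = b ∧ E (π i) (π (i + 1)) ∧
      (own (π i) = b → π (i + 1) = σ (π i))) → Wins c b π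

/-- Positional determinacy of parity games on finite arenas, by Zielonka's recursion. -/
theorem exists_isSolution {V : Type*} (E : V → V → Prop) (own : V → Bool) (c : V → ℕ)
    (S : Finset V) (hS : ∀ v ∈ S, ∃ w ∈ S, E v w) :
    ∃ (side : V → Bool) (σ : V → V), IsSolution E own c S side σ := by
  classical
  induction S using Finset.strongInduction with
  | _ S ih =>
  rcases S.eq_empty_or_nonempty with rfl | hne
  · exact ⟨fun _ => true, id, by simp, by simp, fun b π h => by simpa using (h 0).1⟩
  obtain ⟨m, hm, hmax⟩ := Finset.exists_max_image S c hne
  obtain ⟨b, hb⟩ : ∃ b, decide (Even (c m)) = b := ⟨_, rfl⟩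
  set T := S.filter fun v => c v = c m with hTdef
  obtain ⟨A, rA, σA, hTA, hAS, hA, hA'⟩ := exists_attractor E own b S T (Finset.filter_subset _ _)
  have hmA : m ∈ A := hTA (Finset.mem_filter.2 ⟨hm, rfl⟩)
  obtain ⟨side₁, σ₁, h₁⟩ := ih (S \ A)
    (Finset.sdiff_ssubset hAS ⟨m, hmA⟩) (fun v hv => by
      obtain ⟨hvS, hvA⟩ := Finset.mem_sdiff.1 hv
      by_cases hvb : own v = b
      · obtain ⟨w, hw, hE⟩ := hS v hvS
        exact ⟨w, Finset.mem_sdiff.2 ⟨hw, fun hwA => (hA' v hvS hvA).1 hvb w hwA hE⟩, hE⟩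
      · obtain ⟨w, hw, hwA, hE⟩ := (hA' v hvS hvA).2 hvb
        exact ⟨w, Finset.mem_sdiff.2 ⟨hw, hwA⟩, hE⟩)
  set W := (S \ A).filter fun v => side₁ v ≠ b with hWdef
  have hWS : W ⊆ S := (Finset.filter_subset _ _).trans Finset.sdiff_subset
  have memW : ∀ v, v ∈ W ↔ (v ∈ S ∧ v ∉ A) ∧ side₁ v = !b := by
    intro v
    rw [hWdef, Finset.mem_filter, Finset.mem_sdiff, Bool.eq_not]
  rcases W.eq_empty_or_nonempty with hW | hW
  · -- Player `b` wins everywhere.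
    have hside : ∀ v ∈ S, v ∉ A → side₁ v = b := by
      intro v hv hvA
      by_contra hvb
      have : v ∈ W := (memW v).2 ⟨⟨hv, hvA⟩, Bool.eq_not.2 hvb⟩
      simp [hW] at this
    choose! s hsS hsE using hS
    refine ⟨fun _ => b, fun v => if v ∈ A then if v ∈ T then s v else σA v else σ₁ v, ?_, ?_, ?_⟩
    · intro v hv hvb
      by_cases hvA : v ∈ A
      · by_cases hvT : v ∈ T
        · simp [hvA, hvT, hsS v hv, hsE v hv]
        · obtain ⟨hE, hX, -⟩ := (hA v hvA hvT).1 hvb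
          simp [hvA, hvT, hE, hAS hX]
      · have := h₁.move v (Finset.mem_sdiff.2 ⟨hv, hvA⟩) (by rw [hside v hv hvA, hvb])
        simp [hvA, this.1, (Finset.mem_sdiff.1 this.2.1).1]
    · intros; rfl
    · intro b' π hπ
      obtain rfl : b = b' := (hπ 0).2.1
      by_cases hfin : ∃ k, ∀ i, k ≤ i → π i ∉ A
      · obtain ⟨k, hk⟩ := hfin
        refine Wins.of_shift k (h₁.wins b _ fun i => ?_)
        have hnA := hk (k + i) (by omega)
        obtain ⟨h1, -, h3, h4⟩ := hπ (k + i)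
        refine ⟨Finset.mem_sdiff.2 ⟨h1, hnA⟩, hside _ h1 hnA, h3, fun ho => ?_⟩
        have := h4 ho
        rwa [if_neg hnA] at this
      · push Not at hfin
        refine ⟨c m, hb, fun N => ?_, 0, fun i _ => hmax _ (hπ i).1⟩
        obtain ⟨k, hk, hkA⟩ := hfin N
        obtain ⟨j, hj, hjT⟩ := exists_mem_of_rank_lt (π := π) (T := T) (r := rA)
          (fun i hiA hiT => by
            obtain ⟨-, -, h3, h4⟩ := hπ i
            by_cases ho : own (π i) = b
            · have := h4 ho
              rw [if_pos hiA, if_neg hiT] at this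
              rw [this]
              exact ((hA _ hiA hiT).1 ho).2
            · exact (hA _ hiA hiT).2 ho _ (hπ (i + 1)).1 h3) k hkA
        exact ⟨j, by omega, (Finset.mem_filter.1 hjT).2⟩
  · -- The opponent wins on the attractor of `W`.
    obtain ⟨B, rB, σB, hWB, hBS, hB, hB'⟩ := exists_attractor E own (!b) S W hWS
    obtain ⟨side₂, σ₂, h₂⟩ := ih (S \ B)
      (Finset.sdiff_ssubset hBS (hW.mono hWB)) (fun v hv => by
        obtain ⟨hvS, hvB⟩ := Finset.mem_sdiff.1 hv
        by_cases hvb : own v = !b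
        · obtain ⟨w, hw, hE⟩ := hS v hvS
          exact ⟨w, Finset.mem_sdiff.2 ⟨hw, fun hwB => (hB' v hvS hvB).1 hvb w hwB hE⟩, hE⟩
        · obtain ⟨w, hw, hwB, hE⟩ := (hB' v hvS hvB).2 hvb
          exact ⟨w, Finset.mem_sdiff.2 ⟨hw, hwB⟩, hE⟩)
    have hWmove : ∀ v ∈ W, own v = (!b) → E v (σ₁ v) ∧ σ₁ v ∈ W := by
      intro v hv ho
      obtain ⟨hvS, hvs⟩ := (memW v).1 hv
      obtain ⟨h1, h2, h3⟩ := h₁.move v (Finset.mem_sdiff.2 hvS) (by rw [ho, hvs])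
      exact ⟨h1, (memW _).2 ⟨Finset.mem_sdiff.1 h2, h3.trans hvs⟩⟩
    have hWclosed : ∀ v ∈ W, own v ≠ (!b) → ∀ w ∈ S, E v w → w ∈ W := by
      intro v hv ho w hw hE
      obtain ⟨hvS, hvs⟩ := (memW v).1 hv
      have hwA : w ∉ A := fun hwA =>
        (hA' v hvS.1 hvS.2).1 (by simpa [Bool.eq_not] using ho) w hwA hE
      exact (memW w).2 ⟨⟨hw, hwA⟩, (h₁.closed v (Finset.mem_sdiff.2 hvS) (by rwa [hvs]) w
        (Finset.mem_sdiff.2 ⟨hw, hwA⟩) hE).trans hvs⟩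
    refine ⟨fun v => if v ∈ B then !b else side₂ v,
      fun v => if v ∈ W then σ₁ v else if v ∈ B then σB v else σ₂ v, ?_, ?_, ?_⟩
    · intro v hv ho
      by_cases hvW : v ∈ W
      · have hvB := hWB hvW
        simp only [if_pos hvB] at ho
        obtain ⟨hE, hw⟩ := hWmove v hvW ho
        simp [hvW, hvB, hE, hWS hw, hWB hw]
      · by_cases hvB : v ∈ B
        · simp only [if_pos hvB] at ho
          obtain ⟨hE, hw, -⟩ := (hB v hvB hvW).1 ho
          simp [hvW, hvB, hE, hw, hBS hw]
        · simp only [if_neg hvB] at ho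
          obtain ⟨h1, h2, h3⟩ := h₂.move v (Finset.mem_sdiff.2 ⟨hv, hvB⟩) ho
          obtain ⟨h2, h2'⟩ := Finset.mem_sdiff.1 h2
          simp [hvW, hvB, h1, h2, h2', h3]
    · intro v hv ho w hw hE
      by_cases hvB : v ∈ B
      · simp only [if_pos hvB] at ho ⊢
        have : w ∈ B := by
          by_cases hvW : v ∈ W
          · exact hWB (hWclosed v hvW ho w hw hE)
          · exact ((hB v hvB hvW).2 ho w hw hE).1
        rw [if_pos this]
      · simp only [if_neg hvB] at ho ⊢
        by_cases hwB : w ∈ B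
        · rw [if_pos hwB]
          have : own v ≠ !b := fun h => (hB' v hv hvB).1 h w hwB hE
          revert this ho
          cases own v <;> cases side₂ v <;> cases b <;> simp
        · rw [if_neg hwB]
          exact h₂.closed v (Finset.mem_sdiff.2 ⟨hv, hvB⟩) ho w (Finset.mem_sdiff.2 ⟨hw, hwB⟩) hE
    · intro b' π hπ
      by_cases hhit : ∃ k, π k ∈ B
      · obtain ⟨k, hk⟩ := hhit
        have hb' : b' = !b := by
          have := (hπ k).2.1
          rw [if_pos hk] at this
          exact this.symm
        subst hb'
        obtain ⟨j, -, hjW⟩ := exists_mem_of_rank_lt (π := π) (T := W) (r := rB)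
          (fun i hiB hiW => by
            obtain ⟨-, -, h3, h4⟩ := hπ i
            by_cases ho : own (π i) = !b
            · have := h4 ho
              rw [if_neg hiW, if_pos hiB] at this
              rw [this]
              exact ((hB _ hiB hiW).1 ho).2
            · exact (hB _ hiB hiW).2 ho _ (hπ (i + 1)).1 h3) k hk
        have hstay : ∀ i, π (j + i) ∈ W := by
          intro i
          induction i with
          | zero => exact hjW
          | succ i ihi =>
            obtain ⟨-, -, h3, h4⟩ := hπ (j + i)
            by_cases ho : own (π (j + i)) = !b
            · have := h4 ho
              rw [if_pos ihi] at this
              rw [← add_assoc, this]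
              exact (hWmove _ ihi ho).2
            · exact hWclosed _ ihi ho _ (hπ (j + (i + 1))).1 h3
        refine Wins.of_shift j (h₁.wins _ _ fun i => ?_)
        obtain ⟨hvS, hvs⟩ := (memW _).1 (hstay i)
        obtain ⟨-, -, h3, h4⟩ := hπ (j + i)
        refine ⟨Finset.mem_sdiff.2 hvS, hvs, h3, fun ho => ?_⟩
        have := h4 ho
        rwa [if_pos (hstay i)] at this
      · push Not at hhit
        refine h₂.wins b' π fun i => ?_
        obtain ⟨h1, h2, h3, h4⟩ := hπ i
        rw [if_neg (hhit i)] at h2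
        refine ⟨Finset.mem_sdiff.2 ⟨h1, hhit i⟩, h2, h3, fun ho => ?_⟩
        have := h4 ho
        rwa [if_neg (fun h => hhit i (hWB h)), if_neg (hhit i)] at this

/-- The play of Eve's strategy `σ` against Adam's positional strategy `τ`, as a sequence of
pairs of a history and a current vertex. -/
noncomputable def runAgainst (G : ParityGame) (σ : EveStrategy G) (τ : G.V → G.V) (v : G.V) :
    ℕ → List G.V × G.V
  | 0 => ([], v)
  | i + 1 =>
    let s := runAgainst G σ τ v i
    open Classical in (s.1 ++ [s.2], if s.2 ∈ G.EveV then σ.move s.1 s.2 else τ s.2)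

theorem runAgainst_fst (G : ParityGame) (σ : EveStrategy G) (τ : G.V → G.V) (v : G.V) (i : ℕ) :
    (runAgainst G σ τ v i).1 = (List.range i).map fun j => (runAgainst G σ τ v j).2 := by
  induction i with
  | zero => rfl
  | succ i ih => rw [List.range_succ, List.map_append, ← ih]; rfl

end ParityGame

/-- Parity games are positionally determined for Eve: there is a single
positional strategy `σ : V_E → V` such that from every vertex from which Eve wins, every play
consistent with `σ` satisfies the parity objective. -/
theorem parity_positionally_determined (G : ParityGame) (hd : Even G.d) :
    ∃ σ : G.V → G.V,
      (∀ v ∈ G.EveV, G.E v (σ v)) ∧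
      ∀ v : G.V, G.EveWinsFrom v →
        ∀ π : ℕ → G.V, G.IsPlay v π → (∀ i, π i ∈ G.EveV → π (i + 1) = σ (π i)) →
          G.SatParity π := by
  classical
  obtain ⟨side, τ, h⟩ := ParityGame.exists_isSolution G.E (fun v => decide (v ∈ G.EveV)) G.c
    Finset.univ (fun v _ => by simpa using G.exists_succ v)
  choose s hs using G.exists_succ
  refine ⟨fun v => if side v = true then τ v else s v, fun v hv => ?_, fun v hv π hπ hcons => ?_⟩
  · dsimp only
    split_ifs with hside
    · exact (h.move v (Finset.mem_univ v) (by simp [hv, hside])).1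
    · exact hs v
  have hv0 : side v = true := by
    obtain ⟨σ, hσ⟩ := hv
    by_contra hside
    rw [Bool.not_eq_true] at hside
    set ρ : ℕ → G.V := fun i => (G.runAgainst σ τ v i).2 with hρ
    have hsucc : ∀ i, ρ (i + 1) =
        if ρ i ∈ G.EveV then σ.move ((List.range i).map ρ) (ρ i) else τ (ρ i) := by
      intro i
      rw [hρ, ← ParityGame.runAgainst_fst]
      rfl
    have hstep : ∀ i, side (ρ i) = false → G.E (ρ i) (ρ (i + 1)) ∧ side (ρ (i + 1)) = false := by
      intro i hi
      rw [hsucc i]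
      split_ifs with hE
      · have hmove := σ.follows ((List.range i).map ρ) (ρ i) hE
        exact ⟨hmove, (h.closed _ (Finset.mem_univ _) (by simp [hE, hi]) _
          (Finset.mem_univ _) hmove).trans hi⟩
      · obtain ⟨h1, -, h3⟩ := h.move (ρ i) (Finset.mem_univ _) (by simp [hE, hi])
        exact ⟨h1, h3.trans hi⟩
    have hstay : ∀ i, side (ρ i) = false := by
      intro i
      induction i with
      | zero => exact hside
      | succ i ih => exact (hstep i ih).2
    have hwin : ParityGame.Wins G.c false ρ := h.wins false ρ fun i =>
      ⟨Finset.mem_univ _, hstay i, (hstep i (hstay i)).1, fun ho => by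
        rw [hsucc i, if_neg (by simpa using ho)]⟩
    have := (G.satParity_iff_wins ρ false hwin).1
      (hσ ρ ⟨rfl, fun i => (hstep i (hstay i)).1⟩ fun i hi => by rw [hsucc i, if_pos hi])
    exact Bool.false_ne_true this
  have hstay : ∀ i, side (π i) = true := by
    intro i
    induction i with
    | zero => rwa [hπ.1]
    | succ i ih =>
      by_cases hE : π i ∈ G.EveV
      · have := hcons i hE
        simp only [if_pos ih] at this
        rw [this]
        exact (h.move _ (Finset.mem_univ _) (by simp [hE, ih])).2.2.trans ih
      · exact (h.closed _ (Finset.mem_univ _) (by simp [hE, ih]) _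
          (Finset.mem_univ _) (hπ.2 i)).trans ih
  refine (G.satParity_iff_wins π true (h.wins true π fun i =>
    ⟨Finset.mem_univ _, hstay i, hπ.2 i, fun ho => ?_⟩)).2 rfl
  have := hcons i (by simpa using ho)
  simpa only [if_pos (hstay i)] using this
end

section
/- Let G be a parity game and σ a positional strategy for Eve. If every cycle consistent with σ has even largest priority — that is, for every finite sequence v_1, …, v_k of vertices with (v_i, v_{i+1}) ∈ E for i < k and (v_k, v_1) ∈ E, with v_{i+1} = σ(v_i) whenever v_i ∈ V_E (and v_1 = σ(v_k) if v_k ∈ V_E), the maximum of c(v_1), …, c(v_k) is even — then every play consistent with σ satisfies the parity objective. -/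
theorem exists_forall_ge_recurrent {α : Type*} [Finite α] (π : ℕ → α) :
    ∃ N, ∀ i, N ≤ i → ∀ M, ∃ j, M ≤ j ∧ π j = π i := by
  have h : ∀ᶠ i in Filter.atTop, ∀ v, π i = v → ∀ M, ∃ j, M ≤ j ∧ π j = v := by
    rw [Filter.eventually_all]
    intro v
    by_cases hv : ∀ M, ∃ j, M ≤ j ∧ π j = v
    · exact Filter.Eventually.of_forall fun _ _ => hv
    · push Not at hv
      obtain ⟨M, hM⟩ := hv
      filter_upwards [Filter.eventually_ge_atTop M] with i hi hiv
      exact absurd hiv (hM i hi)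
  obtain ⟨N, hN⟩ := Filter.eventually_atTop.mp h
  exact ⟨N, fun i hi => hN i hi _ rfl⟩

/-- If `σ` is a positional strategy for Eve such that every cycle consistent
with `σ` (a cyclic sequence `v_1, …, v_k` following edges, following `σ` at Eve's vertices,
including around the wrap) has even largest priority, then every play consistent with `σ`
satisfies the parity objective. -/
theorem even_cycles_implies_parity (G : ParityGame) (hd : Even G.d)
    (σ : G.V → G.V) (hσ : ∀ v ∈ G.EveV, G.E v (σ v))
    (hcyc : ∀ (k : ℕ) (vs : Fin (k + 1) → G.V),
      (∀ i : Fin (k + 1), G.E (vs i) (vs (i + 1))) →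
      (∀ i : Fin (k + 1), vs i ∈ G.EveV → vs (i + 1) = σ (vs i)) →
      Even ((Finset.univ : Finset (Fin (k + 1))).sup fun i => G.c (vs i))) :
    ∀ π : ℕ → G.V, (∀ i, G.E (π i) (π (i + 1))) →
      (∀ i, π i ∈ G.EveV → π (i + 1) = σ (π i)) →
      G.SatParity π := by
  intro π hE hcons
  obtain ⟨N, hN⟩ := exists_forall_ge_recurrent π
  unfold ParityGame.SatParity
  set S : Set ℕ := {p | ∀ N, ∃ i, N ≤ i ∧ G.c (π i) = p} with hS
  have hmem : ∀ i, N ≤ i → G.c (π i) ∈ S := fun i hi M =>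
    (hN i hi M).imp fun j hj => ⟨hj.1, congrArg G.c hj.2⟩
  have hbdd : BddAbove S := by
    refine ⟨G.d, fun p hp => ?_⟩
    obtain ⟨i, -, rfl⟩ := hp 0
    exact G.c_le_d _
  have hsup : sSup S ∈ S := Nat.sSup_mem ⟨_, hmem N le_rfl⟩ hbdd
  obtain ⟨i, hi, hci⟩ := hsup N
  obtain ⟨j, hj, hji⟩ := hN i hi (i + 1)
  obtain ⟨k, rfl⟩ := Nat.exists_eq_add_of_le hj
  have hsucc : ∀ t : Fin (k + 1), π (i + (t + 1 : Fin (k + 1)).val) = π (i + t.val + 1) := by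
    intro t
    rw [Fin.val_add_one]
    split_ifs with ht
    · subst ht
      rw [Fin.val_last, add_zero, ← hji]
      congr 1
      omega
    · rw [add_assoc]
  have heven := hcyc k (fun t => π (i + t.val))
    (fun t => by rw [hsucc]; exact hE _)
    (fun t ht => by rw [hsucc]; exact hcons _ ht)
  convert heven using 1
  refine le_antisymm ?_ (Finset.sup_le fun t _ => le_csSup hbdd (hmem _ (by omega)))
  rw [← hci]
  exact Finset.le_sup (f := fun t : Fin (k + 1) => G.c (π (i + t.val))) (Finset.mem_univ 0)
end

section
/- For all n, h ≥ 1 there exists an (n, h)-universal tree with at most f(n, h) leaves, where f : ℕ × ℕ → ℕ is defined by f(0, h) = 0, f(n, 1) = n, f(1, h) = 1, and, for n ≥ 2 and h ≥ 2, f(n, h) = f(n, h−1) + f(⌊n/2⌋, h) + f(n − 1 − ⌊n/2⌋, h). -/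
/-- Length of the longest common prefix of two lists. -/
def lcpLen : List ℕ → List ℕ → ℕ
  | a :: x, b :: y => if a = b then lcpLen x y + 1 else 0
  | _, _ => 0

/-- An ordered tree of height `h` with all leaves at depth exactly `h`, represented by its
(finite, nonempty) set of leaves: lists of child indices of length `h`. -/
def IsTree (h : ℕ) (L : Finset (List ℕ)) : Prop :=
  L.Nonempty ∧ ∀ x ∈ L, x.length = h

/-- An embedding of the tree with leaf set `L'` into the tree with leaf set `L`:
an injective map, strictly monotone for the lexicographic order,
preserving lengths of longest common prefixes. -/
def TreeEmbeds (L' L : Finset (List ℕ)) : Prop :=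
  ∃ f : List ℕ → List ℕ,
    (∀ x ∈ L', f x ∈ L) ∧
    (∀ x ∈ L', ∀ y ∈ L', f x = f y → x = y) ∧
    (∀ x ∈ L', ∀ y ∈ L', List.Lex (· < ·) x y → List.Lex (· < ·) (f x) (f y)) ∧
    (∀ x ∈ L', ∀ y ∈ L', lcpLen (f x) (f y) = lcpLen x y)

/-- A tree is `(n, h)`-universal if every tree of height `h` with at most `n` leaves
embeds into it. -/
def UniversalTree (n h : ℕ) (T : Finset (List ℕ)) : Prop :=
  IsTree h T ∧ ∀ L : Finset (List ℕ), IsTree h L → L.card ≤ n → TreeEmbeds L T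
/-- The upper-bound recurrence `f`. -/
def ubf : ℕ → ℕ → ℕ
  | 0, _ => 0
  | _ + 1, 0 => 0
  | n + 1, 1 => n + 1
  | 1, _ + 2 => 1
  | n + 2, h + 2 =>
      ubf (n + 2) (h + 1) + ubf ((n + 2) / 2) (h + 2) + ubf (n + 2 - 1 - (n + 2) / 2) (h + 2)
termination_by n h => (h, n)
decreasing_by
  · apply Prod.Lex.left; omega
  · apply Prod.Lex.right; omega
  · apply Prod.Lex.right; omega

/-- The tree obtained by increasing the root child indices of a leaf by `m`. -/
def shiftHead (m : ℕ) : List ℕ → List ℕ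
  | [] => []
  | a :: x => (a + m) :: x

@[simp] lemma length_shiftHead (m : ℕ) (x : List ℕ) : (shiftHead m x).length = x.length := by
  cases x <;> simp [shiftHead]

lemma lcpLen_shiftHead (m : ℕ) (x y : List ℕ) :
    lcpLen (shiftHead m x) (shiftHead m y) = lcpLen x y := by
  cases x <;> cases y <;> simp [shiftHead, lcpLen]

lemma lex_shiftHead {m : ℕ} {x y : List ℕ} (h : List.Lex (· < ·) x y) :
    List.Lex (· < ·) (shiftHead m x) (shiftHead m y) := by
  cases h with
  | nil => exact .nil
  | cons h => exact .cons h
  | rel h => exact .rel (Nat.add_lt_add_right h m)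

lemma lcpLen_self (x : List ℕ) : lcpLen x x = x.length := by
  induction x with
  | nil => simp [lcpLen]
  | cons a x ih => simp [lcpLen, ih]

lemma eq_of_lcpLen_eq_length {x y : List ℕ} (hlen : x.length = y.length)
    (h : lcpLen x y = x.length) : x = y := by
  induction x generalizing y with
  | nil => exact (List.length_eq_zero_iff.1 hlen.symm).symm
  | cons a x ih =>
    cases y with
    | nil => simp at hlen
    | cons b y =>
      by_cases hab : a = b
      · simp only [lcpLen, hab, if_true, List.length_cons, Nat.add_right_cancel_iff] at h hlen
        rw [hab, ih hlen h]
      · simp [lcpLen, hab] at h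

/-- On trees of the same height, injectivity of an embedding follows from the preservation of
lengths of common prefixes. -/
lemma TreeEmbeds.of_lcpLen {h : ℕ} {L T : Finset (List ℕ)} (hL : ∀ x ∈ L, x.length = h)
    (hT : ∀ x ∈ T, x.length = h) (f : List ℕ → List ℕ) (hf : ∀ x ∈ L, f x ∈ T)
    (hlex : ∀ x ∈ L, ∀ y ∈ L, List.Lex (· < ·) x y → List.Lex (· < ·) (f x) (f y))
    (hlcp : ∀ x ∈ L, ∀ y ∈ L, lcpLen (f x) (f y) = lcpLen x y) : TreeEmbeds L T := by
  refine ⟨f, hf, fun x hx y hy hxy => ?_, hlex, hlcp⟩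
  refine eq_of_lcpLen_eq_length ((hL x hx).trans (hL y hy).symm) ?_
  rw [← hlcp x hx y hy, ← hxy, lcpLen_self, hT _ (hf x hx), hL x hx]

lemma TreeEmbeds.mono {L T T' : Finset (List ℕ)} (h : TreeEmbeds L T) (hT : T ⊆ T') :
    TreeEmbeds L T' := by
  obtain ⟨f, hf, h⟩ := h
  exact ⟨f, fun x hx => hT (hf x hx), h⟩

/-- There is a set of at most `c` leaves of depth `h` into which every (possibly empty) set of
at most `n` leaves of depth `h` embeds. -/
def HasUniversal (n h c : ℕ) : Prop :=
  ∃ T : Finset (List ℕ), (∀ x ∈ T, x.length = h) ∧ T.card ≤ c ∧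
    ∀ L : Finset (List ℕ), (∀ x ∈ L, x.length = h) → L.card ≤ n → TreeEmbeds L T

lemma hasUniversal_zero_left (h c : ℕ) : HasUniversal 0 h c := by
  refine ⟨∅, by simp, by simp, fun L _ hL => ?_⟩
  obtain rfl : L = ∅ := by simpa using hL
  exact ⟨id, by simp⟩

lemma hasUniversal_zero_right (n : ℕ) : HasUniversal n 0 1 := by
  refine ⟨{[]}, by simp, by simp, fun L hL _ => ⟨id, ?_, by simp⟩⟩
  intro x hx
  simpa using hL x hx

/-- A root child splitting the leaves into at most `k` leaves strictly to its left and fewer than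
`L.card - k` leaves strictly to its right. -/
lemma exists_splitting_child {L : Finset (List ℕ)} {k : ℕ} (hk : k < L.card) :
    ∃ j : ℕ, (L.filter (·.headI < j)).card ≤ k ∧
      (L.filter (j < ·.headI)).card + k < L.card := by
  have hex : ∃ j, k < (L.filter (·.headI ≤ j)).card := by
    refine ⟨L.sup List.headI, ?_⟩
    rwa [Finset.filter_true_of_mem fun x hx => Finset.le_sup (f := List.headI) hx]
  classical
  refine ⟨Nat.find hex, ?_, ?_⟩
  · rcases hj : Nat.find hex with _ | i
    · simp
    · have := Nat.find_min hex (m := i) (by omega)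
      simpa [Nat.lt_succ_iff] using this
  · have h₁ := Nat.find_spec hex
    have h₂ := Finset.card_filter_add_card_filter_not (s := L) (·.headI ≤ Nat.find hex)
    simp only [not_le] at h₂
    omega

/-- The tree whose root children are those of `A`, then a child `m` carrying `B`, then those of
`C`. -/
def glue (m : ℕ) (A B C : Finset (List ℕ)) : Finset (List ℕ) :=
  A ∪ B.image (m :: ·) ∪ C.image (shiftHead (m + 1))

lemma card_glue_le (m : ℕ) (A B C : Finset (List ℕ)) :
    (glue m A B C).card ≤ B.card + A.card + C.card := by
  have h₁ := Finset.card_union_le (A ∪ B.image (m :: ·)) (C.image (shiftHead (m + 1)))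
  have h₂ := Finset.card_union_le A (B.image (m :: ·))
  have h₃ := Finset.card_image_le (s := B) (f := (m :: ·))
  have h₄ := Finset.card_image_le (s := C) (f := shiftHead (m + 1))
  unfold glue
  omega

lemma length_of_mem_glue {m h : ℕ} {A B C : Finset (List ℕ)} (hA : ∀ x ∈ A, x.length = h + 1)
    (hB : ∀ x ∈ B, x.length = h) (hC : ∀ x ∈ C, x.length = h + 1) :
    ∀ x ∈ glue m A B C, x.length = h + 1 := by
  intro x hx
  simp only [glue, Finset.mem_union, Finset.mem_image] at hx
  rcases hx with (hx | ⟨y, hy, rfl⟩) | ⟨y, hy, rfl⟩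
  · exact hA x hx
  · simp [hB y hy]
  · simp [hC y hy]

lemma lcpLen_of_headI_ne {x y : List ℕ} (h : x.headI ≠ y.headI) : lcpLen x y = 0 := by
  cases x <;> cases y <;> simp_all [lcpLen]

lemma lex_of_headI_lt {x y : List ℕ} (h : x.headI < y.headI) : List.Lex (· < ·) x y := by
  cases y with
  | nil => simp at h
  | cons b y =>
    cases x with
    | nil => exact .nil
    | cons a x => exact .rel h

lemma headI_le_of_lex {x y : List ℕ} (h : List.Lex (· < ·) x y) (hx : x ≠ []) :
    x.headI ≤ y.headI := by
  cases h with
  | nil => exact absurd rfl hx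
  | cons h => simp
  | rel h => exact le_of_lt h

lemma treeEmbeds_glue {m j h : ℕ} {L A B C : Finset (List ℕ)}
    (hL : ∀ x ∈ L, x.length = h + 1) (hA : ∀ x ∈ A, x.length = h + 1)
    (hB : ∀ x ∈ B, x.length = h) (hC : ∀ x ∈ C, x.length = h + 1)
    (hm : ∀ x ∈ A, x.headI < m)
    (eA : TreeEmbeds (L.filter (·.headI < j)) A)
    (eB : TreeEmbeds ((L.filter (·.headI = j)).image List.tail) B)
    (eC : TreeEmbeds (L.filter (j < ·.headI)) C) : TreeEmbeds L (glue m A B C) := by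
  obtain ⟨f, hf, -, flex, flcp⟩ := eA
  obtain ⟨g, hg, -, glex, glcp⟩ := eB
  obtain ⟨k, hk, -, klex, klcp⟩ := eC
  simp only [Finset.mem_filter, and_imp] at hf flex flcp hk klex klcp
  have hg' : ∀ x ∈ L, x.headI = j → g x.tail ∈ B := fun x hx hxj =>
    hg _ (Finset.mem_image_of_mem _ (Finset.mem_filter.2 ⟨hx, hxj⟩))
  have glex' : ∀ x ∈ L, x.headI = j → ∀ y ∈ L, y.headI = j →
      List.Lex (· < ·) x.tail y.tail → List.Lex (· < ·) (g x.tail) (g y.tail) :=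
    fun x hx hxj y hy hyj =>
      glex _ (Finset.mem_image_of_mem _ (Finset.mem_filter.2 ⟨hx, hxj⟩))
        _ (Finset.mem_image_of_mem _ (Finset.mem_filter.2 ⟨hy, hyj⟩))
  have glcp' : ∀ x ∈ L, x.headI = j → ∀ y ∈ L, y.headI = j →
      lcpLen (g x.tail) (g y.tail) = lcpLen x.tail y.tail :=
    fun x hx hxj y hy hyj =>
      glcp _ (Finset.mem_image_of_mem _ (Finset.mem_filter.2 ⟨hx, hxj⟩))
        _ (Finset.mem_image_of_mem _ (Finset.mem_filter.2 ⟨hy, hyj⟩))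
  have hcons : ∀ x ∈ L, x = x.headI :: x.tail := by
    intro x hx
    cases x with
    | nil => simpa using hL _ hx
    | cons a x => rfl
  let F : List ℕ → List ℕ := fun x =>
    if x.headI < j then f x else if x.headI = j then m :: g x.tail else shiftHead (m + 1) (k x)
  have Flt : ∀ x, x.headI < j → F x = f x := fun x hx => if_pos hx
  have Feq : ∀ x, x.headI = j → F x = m :: g x.tail := fun x hx => by simp [F, hx]
  have Fgt : ∀ x, j < x.headI → F x = shiftHead (m + 1) (k x) := fun x hx => by
    simp [F, hx.ne', hx.not_gt]
  have Hlt : ∀ x ∈ L, x.headI < j → (F x).headI < m := fun x hx hxj => by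
    rw [Flt x hxj]; exact hm _ (hf x hx hxj)
  have Heq : ∀ x, x.headI = j → (F x).headI = m := fun x hxj => by rw [Feq x hxj]; rfl
  have Hgt : ∀ x ∈ L, j < x.headI → m < (F x).headI := fun x hx hxj => by
    rw [Fgt x hxj]
    have := hC _ (hk x hx hxj)
    cases hkx : k x with
    | nil => simp [hkx] at this
    | cons a y => simp only [shiftHead, List.headI_cons]; omega
  refine .of_lcpLen hL (length_of_mem_glue hA hB hC) F ?_ ?_ ?_
  · intro x hx
    simp only [glue, Finset.mem_union]
    rcases lt_trichotomy x.headI j with hxj | hxj | hxj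
    · rw [Flt x hxj]; exact .inl (.inl (hf x hx hxj))
    · rw [Feq x hxj]; exact .inl (.inr (Finset.mem_image_of_mem _ (hg' x hx hxj)))
    · rw [Fgt x hxj]; exact .inr (Finset.mem_image_of_mem _ (hk x hx hxj))
  · intro x hx y hy hxy
    have hle : x.headI ≤ y.headI := headI_le_of_lex hxy fun h0 => by simpa [h0] using hL x hx
    rcases lt_trichotomy x.headI j with hxj | hxj | hxj <;>
      rcases lt_trichotomy y.headI j with hyj | hyj | hyj
    · rw [Flt x hxj, Flt y hyj]; exact flex x hx hxj y hy hyj hxy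
    · exact lex_of_headI_lt ((Hlt x hx hxj).trans_eq (Heq y hyj).symm)
    · exact lex_of_headI_lt ((Hlt x hx hxj).trans (Hgt y hy hyj))
    · omega
    · rw [Feq x hxj, Feq y hyj]
      rw [hcons x hx, hcons y hy, hxj, hyj] at hxy
      exact .cons (glex' x hx hxj y hy hyj (by simpa using hxy))
    · exact lex_of_headI_lt ((Heq x hxj).trans_lt (Hgt y hy hyj))
    · omega
    · omega
    · rw [Fgt x hxj, Fgt y hyj]; exact lex_shiftHead (klex x hx hxj y hy hyj hxy)
  · intro x hx y hy
    have hne : x.headI ≠ y.headI → (F x).headI ≠ (F y).headI →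
        lcpLen (F x) (F y) = lcpLen x y := fun h₁ h₂ => by
      rw [lcpLen_of_headI_ne h₁, lcpLen_of_headI_ne h₂]
    rcases lt_trichotomy x.headI j with hxj | hxj | hxj <;>
      rcases lt_trichotomy y.headI j with hyj | hyj | hyj
    · rw [Flt x hxj, Flt y hyj]; exact flcp x hx hxj y hy hyj
    · have := Hlt x hx hxj; have := Heq y hyj; exact hne (by omega) (by omega)
    · have := Hlt x hx hxj; have := Hgt y hy hyj; exact hne (by omega) (by omega)
    · have := Heq x hxj; have := Hlt y hy hyj; exact hne (by omega) (by omega)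
    · rw [Feq x hxj, Feq y hyj]
      conv_rhs => rw [hcons x hx, hcons y hy, hxj, hyj]
      simp [lcpLen, glcp' x hx hxj y hy hyj]
    · have := Heq x hxj; have := Hgt y hy hyj; exact hne (by omega) (by omega)
    · have := Hgt x hx hxj; have := Hlt y hy hyj; exact hne (by omega) (by omega)
    · have := Hgt x hx hxj; have := Heq y hyj; exact hne (by omega) (by omega)
    · rw [Fgt x hxj, Fgt y hyj, lcpLen_shiftHead]; exact klcp x hx hxj y hy hyj

lemma HasUniversal.succ {n h k a b c : ℕ} (hB : HasUniversal n h a)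
    (hA : HasUniversal k (h + 1) b) (hC : HasUniversal (n - 1 - k) (h + 1) c) :
    HasUniversal n (h + 1) (a + b + c) := by
  obtain ⟨B, lenB, cardB, univB⟩ := hB
  obtain ⟨A, lenA, cardA, univA⟩ := hA
  obtain ⟨C, lenC, cardC, univC⟩ := hC
  refine ⟨glue (A.sup List.headI + 1) A B C, length_of_mem_glue lenA lenB lenC,
    (card_glue_le _ A B C).trans (by omega), fun L hL hn => ?_⟩
  rcases le_or_gt L.card k with hk | hk
  · refine (univA L hL hk).mono fun x hx => ?_
    simp [glue, hx]
  · obtain ⟨j, hlt, hgt⟩ := exists_splitting_child hk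
    refine treeEmbeds_glue (j := j) hL lenA lenB lenC
      (fun x hx => Nat.lt_succ_of_le (Finset.le_sup (f := List.headI) hx))
      (univA _ (fun x hx => hL x (Finset.mem_filter.1 hx).1) hlt)
      (univB _ (fun x hx => ?_)
        (Finset.card_image_le.trans ((Finset.card_filter_le _ _).trans hn)))
      (univC _ (fun x hx => hL x (Finset.mem_filter.1 hx).1) (by omega))
    obtain ⟨y, hy, rfl⟩ := Finset.mem_image.1 hx
    simp [hL y (Finset.mem_filter.1 hy).1]

lemma ubf_zero_left (h : ℕ) : ubf 0 h = 0 := by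
  rw [ubf]

lemma ubf_height_one (n : ℕ) : ubf n 1 = n := by
  cases n <;> rw [ubf]

lemma ubf_one_left (h : ℕ) : ubf 1 (h + 1) = 1 := by
  cases h <;> rw [ubf]

lemma ubf_succ_height {n : ℕ} (hn : 1 ≤ n) (h : ℕ) :
    ubf n (h + 2) =
      ubf n (h + 1) + ubf (n / 2) (h + 2) + ubf (n - 1 - n / 2) (h + 2) := by
  obtain _ | _ | n := n
  · omega
  · simp [ubf_zero_left, ubf_one_left]
  · rw [ubf]

lemma hasUniversal_ubf (n h : ℕ) : HasUniversal n (h + 1) (ubf n (h + 1)) := by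
  induction h generalizing n with
  | zero =>
    induction n using Nat.strong_induction_on with
    | _ n ih =>
      rcases Nat.eq_zero_or_pos n with rfl | hn
      · exact hasUniversal_zero_left _ _
      · have := (hasUniversal_zero_right n).succ (ih (n / 2) (by omega))
          (ih (n - 1 - n / 2) (by omega))
        simp only [zero_add, ubf_height_one] at this ⊢
        rwa [show 1 + n / 2 + (n - 1 - n / 2) = n by omega] at this
  | succ h ihh =>
    induction n using Nat.strong_induction_on with
    | _ n ih =>
      rcases Nat.eq_zero_or_pos n with rfl | hn
      · exact hasUniversal_zero_left _ _
      · rw [ubf_succ_height hn]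
        exact (ihh n).succ (ih (n / 2) (by omega)) (ih (n - 1 - n / 2) (by omega))

/-- For all `n, h ≥ 1` there exists an `(n, h)`-universal tree with at most
`f(n, h)` leaves, where `f(0,h) = 0`, `f(n,1) = n`, `f(1,h) = 1` and, for `n, h ≥ 2`,
`f(n,h) = f(n,h−1) + f(⌊n/2⌋,h) + f(n−1−⌊n/2⌋,h)`. -/
theorem exists_universalTree_ubf (n h : ℕ) (hn : 1 ≤ n) (hh : 1 ≤ h) :
    ∃ T : Finset (List ℕ), UniversalTree n h T ∧ T.card ≤ ubf n h := by
  obtain ⟨h, rfl⟩ := Nat.exists_eq_add_of_le' hh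
  obtain ⟨T, hlen, hcard, huniv⟩ := hasUniversal_ubf n h
  refine ⟨T, ⟨⟨?_, hlen⟩, fun L hL hLn => huniv L hL.2 hLn⟩, hcard⟩
  obtain ⟨f, hf, -⟩ := huniv {List.replicate (h + 1) 0} (by simp) (by simpa using hn)
  exact ⟨_, hf _ (Finset.mem_singleton_self _)⟩
end

section
/- For all n, h ≥ 1, f(n, h) ≤ 2^⌈log₂ n⌉ · C(⌈log₂ n⌉ + h − 1, ⌈log₂ n⌉), where C denotes the binomial coefficient and f : ℕ × ℕ → ℕ is defined by f(0, h) = 0, f(n, 1) = n, f(1, h) = 1, and, for n ≥ 2 and h ≥ 2, f(n, h) = f(n, h−1) + f(⌊n/2⌋, h) + f(n − 1 − ⌊n/2⌋, h). -/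
/-- The bound holds with any exponent `k` such that `n ≤ 2 ^ k` in place of `⌈log₂ n⌉`. -/
theorem ubf_succ_le_of_le_two_pow (h k n : ℕ) (hn : n ≤ 2 ^ k) :
    ubf n (h + 1) ≤ 2 ^ k * (k + h).choose k := by
  induction h generalizing k n with
  | zero =>
    cases n with
    | zero => simp [ubf]
    | succ n => simpa [ubf] using hn
  | succ h ih_height =>
    induction k generalizing n with
    | zero =>
      have : n = 0 ∨ n = 1 := by rw [pow_zero] at hn; omega
      rcases this with rfl | rfl <;> simp [ubf]
    | succ k ih_exp =>
      match n, hn with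
      | 0, _ => simp [ubf]
      | 1, _ =>
        rw [ubf]
        exact Nat.mul_pos (by positivity) (Nat.choose_pos (by omega))
      | m + 2, hn =>
        have hprev := ih_height (k + 1) (m + 2) hn
        rw [pow_succ] at hn
        have hleft := ih_exp ((m + 2) / 2) (by omega)
        have hright := ih_exp (m + 2 - 1 - (m + 2) / 2) (by omega)
        have pascal : (k + 1 + (h + 1)).choose (k + 1) =
            (k + (h + 1)).choose k + (k + 1 + h).choose (k + 1) := by
          rw [show k + 1 + (h + 1) = k + (h + 1) + 1 by omega, Nat.choose_succ_succ',
            show k + (h + 1) = k + 1 + h by omega]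
        rw [ubf, pascal]
        calc
          _ ≤ 2 ^ (k + 1) * (k + 1 + h).choose (k + 1) + 2 ^ k * (k + (h + 1)).choose k
              + 2 ^ k * (k + (h + 1)).choose k := by gcongr
          _ = _ := by ring

/-- For all `n, h ≥ 1`,
`f(n, h) ≤ 2 ^ ⌈log₂ n⌉ * C(⌈log₂ n⌉ + h − 1, ⌈log₂ n⌉)`. -/
theorem ubf_le (n h : ℕ) (hn : 1 ≤ n) (hh : 1 ≤ h) :
    ubf n h ≤ 2 ^ Nat.clog 2 n * Nat.choose (Nat.clog 2 n + h - 1) (Nat.clog 2 n) := by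
  obtain ⟨m, rfl⟩ := Nat.exists_eq_add_of_le' hh
  exact ubf_succ_le_of_le_two_pow m (Nat.clog 2 n) n (Nat.le_pow_clog one_lt_two n)
end

section
/- Let F : ℕ × ℕ → ℕ satisfy F(0, h) = 1 for all h ≥ 1, F(p, 1) = 2^p for all p ≥ 0, and F(p, h) = F(p, h−1) + 2·F(p−1, h) for all p ≥ 1 and h ≥ 2. Then F(p, h) = 2^p · C(p + h − 1, p) for all p ≥ 0 and h ≥ 1. -/
/-- If `F : ℕ × ℕ → ℕ` satisfies `F(0,h) = 1` for `h ≥ 1`, `F(p,1) = 2^p`,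
and `F(p,h) = F(p,h−1) + 2·F(p−1,h)` for `p ≥ 1`, `h ≥ 2`, then
`F(p,h) = 2^p · C(p+h−1, p)` for all `p ≥ 0`, `h ≥ 1`. -/
theorem F_closed_form (F : ℕ → ℕ → ℕ)
    (h0 : ∀ h, 1 ≤ h → F 0 h = 1)
    (h1 : ∀ p, F p 1 = 2 ^ p)
    (hrec : ∀ p h, 1 ≤ p → 2 ≤ h → F p h = F p (h - 1) + 2 * F (p - 1) h) :
    ∀ p h, 1 ≤ h → F p h = 2 ^ p * Nat.choose (p + h - 1) p := by
  intro p
  induction p with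
  | zero => intro h hh; simp [h0 h hh]
  | succ p ihp =>
    intro h hh
    induction h, hh using Nat.le_induction with
    | base => simp [h1]
    | succ h hh ihh =>
      have hr := hrec (p + 1) (h + 1) (by omega) (by omega)
      have hp := ihp (h + 1) (by omega)
      rw [show p + (h + 1) - 1 = p + h by omega] at hp
      rw [show p + 1 + h - 1 = p + h by omega] at ihh
      rw [Nat.add_sub_cancel, Nat.add_sub_cancel, ihh, hp] at hr
      rw [hr, show p + 1 + (h + 1) - 1 = p + h + 1 by omega, Nat.choose_succ_succ']
      ring
end

section
/- For all n, h ≥ 1, every (n, h)-universal tree has at least g(n, h) leaves, where g is defined on pairs of positive integers by g(n, 1) = n, g(1, h) = 1, and, for n ≥ 2 and h ≥ 2, g(n, h) = Σ_{δ=1}^{n} g(⌊n/δ⌋, h−1). -/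
/-- The lower-bound recurrence `g`. -/
def lbg : ℕ → ℕ → ℕ
  | 0, _ => 0
  | _ + 1, 0 => 0
  | n + 1, 1 => n + 1
  | 1, _ + 2 => 1
  | n + 2, h + 2 => ∑ δ ∈ Finset.Icc 1 (n + 2), lbg ((n + 2) / δ) (h + 1)
termination_by n h => (h, n)
decreasing_by
  apply Prod.Lex.left; omega

theorem lcpLen_self_s12 (u : List ℕ) : lcpLen u u = u.length := by
  induction u with
  | nil => simp [lcpLen]
  | cons a u ih => simp [lcpLen, ih]

theorem eq_of_length_le_lcpLen : ∀ {u v : List ℕ}, u.length = v.length →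
    u.length ≤ lcpLen u v → u = v
  | [], [], _, _ => rfl
  | a :: u, b :: v, h, hl => by
    by_cases hab : a = b
    · simp only [lcpLen, hab, if_true, List.length_cons] at hl h
      rw [hab, eq_of_length_le_lcpLen (u := u) (v := v) (by omega) (by omega)]
    · simp [lcpLen, hab] at hl

theorem min_length_lcpLen_append_singleton : ∀ {u v : List ℕ} (a b : ℕ), u.length = v.length →
    min u.length (lcpLen (u ++ [a]) (v ++ [b])) = lcpLen u v
  | [], [], _, _, _ => by simp [lcpLen]
  | c :: u, d :: v, a, b, h => by
    have ih := min_length_lcpLen_append_singleton (u := u) (v := v) a b (by simpa using h)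
    by_cases hcd : c = d
    · simp only [List.cons_append, lcpLen, hcd, if_true, List.length_cons, ← ih]
      omega
    · simp [lcpLen, hcd]

theorem lex_append_singleton : ∀ {u v : List ℕ} (a b : ℕ), u.length = v.length →
    List.Lex (· < ·) u v → List.Lex (· < ·) (u ++ [a]) (v ++ [b])
  | [], [], _, _, _, hl => nomatch hl
  | _ :: _, _ :: _, _, _, _, .rel hl => .rel hl
  | _ :: _, _ :: _, a, b, h, .cons hl => .cons (lex_append_singleton a b (by simpa using h) hl)

theorem lex_or_eq_of_lex_append_singleton : ∀ {u v : List ℕ} {a b : ℕ}, u.length = v.length →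
    List.Lex (· < ·) (u ++ [a]) (v ++ [b]) → List.Lex (· < ·) u v ∨ u = v
  | [], [], _, _, _, _ => .inr rfl
  | _ :: _, _ :: _, _, _, _, .rel hl => .inl (.rel hl)
  | _ :: _, _ :: _, _, _, h, .cons hl =>
    (lex_or_eq_of_lex_append_singleton (by simpa using h) hl).imp .cons (congrArg _)

theorem min_lcpLen_eq_lcpLen_dropLast {h : ℕ} {u v : List ℕ} (hu : u.length = h + 1)
    (hv : v.length = h + 1) : min h (lcpLen u v) = lcpLen u.dropLast v.dropLast := by
  have hu0 : u ≠ [] := by rintro rfl; simp at hu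
  have hv0 : v ≠ [] := by rintro rfl; simp at hv
  have := min_length_lcpLen_append_singleton (u := u.dropLast) (v := v.dropLast)
    (u.getLast hu0) (v.getLast hv0) (by simp [hu, hv])
  rwa [List.dropLast_append_getLast, List.dropLast_append_getLast, List.length_dropLast, hu]
    at this

theorem lex_dropLast_or_eq {h : ℕ} {u v : List ℕ} (hu : u.length = h + 1)
    (hv : v.length = h + 1) (huv : List.Lex (· < ·) u v) :
    List.Lex (· < ·) u.dropLast v.dropLast ∨ u.dropLast = v.dropLast := by
  have hu0 : u ≠ [] := by rintro rfl; simp at hu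
  have hv0 : v ≠ [] := by rintro rfl; simp at hv
  apply lex_or_eq_of_lex_append_singleton (a := u.getLast hu0) (b := v.getLast hv0)
    (by simp [hu, hv])
  rwa [List.dropLast_append_getLast, List.dropLast_append_getLast]

/-- The parents of leaves of `T` that have at least `δ` children. -/
def parentsOfDegreeGE (δ : ℕ) (T : Finset (List ℕ)) : Finset (List ℕ) :=
  {p ∈ T.image List.dropLast | δ ≤ {x ∈ T | x.dropLast = p}.card}

/-- The tree obtained from `L` by giving `δ` children to every leaf. -/
def appendChildren (δ : ℕ) (L : Finset (List ℕ)) : Finset (List ℕ) :=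
  (L ×ˢ Finset.range δ).image fun p => p.1 ++ [p.2]

theorem append_singleton_mem_appendChildren {δ i : ℕ} {L : Finset (List ℕ)} {x : List ℕ}
    (hx : x ∈ L) (hi : i < δ) : x ++ [i] ∈ appendChildren δ L :=
  Finset.mem_image.2 ⟨(x, i), by simp [hx, hi], rfl⟩

theorem IsTree.appendChildren {h δ : ℕ} {L : Finset (List ℕ)} (hL : IsTree h L) (hδ : 0 < δ) :
    IsTree (h + 1) (appendChildren δ L) := by
  obtain ⟨⟨x, hx⟩, hlen⟩ := hL
  refine ⟨⟨_, append_singleton_mem_appendChildren hx hδ⟩, fun y hy => ?_⟩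
  obtain ⟨⟨z, i⟩, hz, rfl⟩ := Finset.mem_image.1 hy
  simp [hlen z (Finset.mem_product.1 hz).1]

theorem card_appendChildren_le (δ : ℕ) (L : Finset (List ℕ)) :
    (appendChildren δ L).card ≤ L.card * δ :=
  Finset.card_image_le.trans (by simp)

theorem TreeEmbeds.parentsOfDegreeGE {h δ : ℕ} {L T : Finset (List ℕ)} (hδ : 0 < δ)
    (hL : ∀ x ∈ L, x.length = h) (hT : ∀ x ∈ T, x.length = h + 1)
    (hLT : TreeEmbeds (appendChildren δ L) T) : TreeEmbeds L (parentsOfDegreeGE δ T) := by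
  obtain ⟨f, hf, hinj, hmono, hlcp⟩ := hLT
  have hmem {x i} (hx : x ∈ L) (hi : i < δ) := append_singleton_mem_appendChildren hx hi
  have hlen {x i} (hx : x ∈ L) (hi : i < δ) : (f (x ++ [i])).length = h + 1 :=
    hT _ (hf _ (hmem hx hi))
  have hlcp' {x y i j} (hx : x ∈ L) (hy : y ∈ L) (hi : i < δ) (hj : j < δ) :
      lcpLen (f (x ++ [i])).dropLast (f (y ++ [j])).dropLast = lcpLen x y := by
    rw [← min_lcpLen_eq_lcpLen_dropLast (hlen hx hi) (hlen hy hj),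
      hlcp _ (hmem hx hi) _ (hmem hy hj),
      ← min_length_lcpLen_append_singleton i j ((hL x hx).trans (hL y hy).symm), hL x hx]
  have hinj' : ∀ x ∈ L, ∀ y ∈ L, (f (x ++ [0])).dropLast = (f (y ++ [0])).dropLast → x = y := by
    intro x hx y hy hxy
    apply eq_of_length_le_lcpLen ((hL x hx).trans (hL y hy).symm)
    rw [← hlcp' hx hy hδ hδ, hxy, lcpLen_self_s12, List.length_dropLast, hlen hy hδ, hL x hx]
    rfl
  refine ⟨fun x => (f (x ++ [0])).dropLast, fun x hx => ?_, hinj', fun x hx y hy hxy => ?_,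
    fun x hx y hy => hlcp' hx hy hδ hδ⟩
  · refine Finset.mem_filter.2 ⟨Finset.mem_image_of_mem _ (hf _ (hmem hx hδ)), ?_⟩
    rw [← Finset.card_range δ]
    refine Finset.card_le_card_of_injOn (fun i => f (x ++ [i])) (fun i hi => ?_)
      fun i hi j hj hij => ?_
    · have hi : i < δ := by simpa using hi
      refine Finset.mem_coe.2 (Finset.mem_filter.2 ⟨hf _ (hmem hx hi), ?_⟩)
      apply eq_of_length_le_lcpLen
      · simp [hlen hx hi, hlen hx hδ]
      · simp [hlcp' hx hx hi hδ, lcpLen_self_s12, hlen hx hi, hL x hx]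
    · simpa using hinj _ (hmem hx (by simpa using hi)) _ (hmem hx (by simpa using hj)) hij
  · refine (lex_dropLast_or_eq (hlen hx hδ) (hlen hy hδ) (hmono _ (hmem hx hδ) _ (hmem hy hδ)
      (lex_append_singleton 0 0 ((hL x hx).trans (hL y hy).symm) hxy))).resolve_right fun he => ?_
    obtain rfl := hinj' x hx y hy he
    exact irrefl_of (List.Lex (· < ·)) x hxy

theorem UniversalTree.parentsOfDegreeGE {n h δ : ℕ} {T : Finset (List ℕ)} (hδ : 0 < δ)
    (hn : δ ≤ n) (hT : UniversalTree n (h + 1) T) :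
    UniversalTree (n / δ) h (parentsOfDegreeGE δ T) := by
  have hemb (L : Finset (List ℕ)) (hL : IsTree h L) (hc : L.card ≤ n / δ) :
      TreeEmbeds L (_root_.parentsOfDegreeGE δ T) :=
    TreeEmbeds.parentsOfDegreeGE hδ hL.2 hT.1.2 <| hT.2 _ (hL.appendChildren hδ) <|
      (card_appendChildren_le δ L).trans <|
        (Nat.mul_le_mul_right δ hc).trans (Nat.div_mul_le_self n δ)
  refine ⟨⟨?_, fun p hp => ?_⟩, hemb⟩
  · obtain ⟨f, hf, -⟩ := hemb {List.replicate h 0} ⟨by simp, by simp⟩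
      (Nat.div_pos hn hδ)
    exact ⟨_, hf _ (Finset.mem_singleton_self _)⟩
  · obtain ⟨x, hx, rfl⟩ := Finset.mem_image.1 (Finset.mem_filter.1 hp).1
    simp [hT.1.2 x hx]

theorem sum_card_parentsOfDegreeGE_le (n : ℕ) (T : Finset (List ℕ)) :
    ∑ δ ∈ Finset.Icc 1 n, (parentsOfDegreeGE δ T).card ≤ T.card := by
  rw [Finset.card_eq_sum_card_image List.dropLast T]
  simp only [parentsOfDegreeGE, Finset.card_filter _ (T.image List.dropLast)]
  rw [Finset.sum_comm]
  refine Finset.sum_le_sum fun p _ => ?_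
  rw [← Finset.card_filter]
  calc _ ≤ (Finset.Icc 1 {x ∈ T | x.dropLast = p}.card).card :=
        Finset.card_le_card fun δ => by simp +contextual
    _ = _ := by simp

theorem UniversalTree.le_card {n h : ℕ} (hn : 1 ≤ n) {T : Finset (List ℕ)}
    (hT : UniversalTree n (h + 1) T) : n ≤ T.card := by
  have hL : IsTree (h + 1) (appendChildren n {List.replicate h 0}) :=
    IsTree.appendChildren ⟨by simp, by simp⟩ hn
  obtain ⟨f, hf, hinj, -⟩ := hT.2 _ hL ((card_appendChildren_le _ _).trans (by simp))
  have hmem {i : ℕ} (hi : i < n) :=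
    append_singleton_mem_appendChildren (Finset.mem_singleton_self (List.replicate h 0)) hi
  rw [← Finset.card_range n]
  refine Finset.card_le_card_of_injOn (fun i => f (List.replicate h 0 ++ [i]))
    (fun i hi => hf _ (hmem (by simpa using hi))) fun i hi j hj hij => ?_
  simpa using hinj _ (hmem (by simpa using hi)) _ (hmem (by simpa using hj)) hij

/-- For all `n, h ≥ 1`, every `(n, h)`-universal tree has at least `g(n, h)`
leaves, where `g(n,1) = n`, `g(1,h) = 1` and, for `n, h ≥ 2`,
`g(n,h) = Σ_{δ=1}^{n} g(⌊n/δ⌋, h−1)`. -/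
theorem universalTree_card_ge_lbg (n h : ℕ) (hn : 1 ≤ n) (hh : 1 ≤ h)
    (T : Finset (List ℕ)) (hT : UniversalTree n h T) :
    lbg n h ≤ T.card := by
  induction h, hh using Nat.le_induction generalizing n T with
  | base =>
    obtain ⟨n, rfl⟩ := Nat.exists_eq_add_of_le' hn
    simpa [lbg] using hT.le_card hn
  | succ h hh ih =>
    obtain ⟨h, rfl⟩ := Nat.exists_eq_add_of_le' hh
    match n, hn with
    | 1, _ => simpa [lbg] using hT.1.1
    | n + 2, _ =>
      rw [lbg]
      refine le_trans (Finset.sum_le_sum fun δ hδ => ?_) (sum_card_parentsOfDegreeGE_le (n + 2) T)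
      obtain ⟨hδ, hδn⟩ := Finset.mem_Icc.1 hδ
      exact ih _ (Nat.div_pos hδn hδ) _ (hT.parentsOfDegreeGE hδ hδn)
end

section
/- Let T be an (n, h)-universal tree with h ≥ 2 and let δ ∈ {1, …, n}. Let T_δ be the tree of height h−1 whose leaf set is the set of nodes of T at depth h−1 having at least δ children (i.e., the length-(h−1) prefixes of leaves of T admitting at least δ distinct length-h extensions to leaves of T). Then T_δ is (⌊n/δ⌋, h−1)-universal. -/
/-- The tree `T_δ` of height `h − 1`: its leaves are the depth-`(h−1)` nodes of `T`
(length-`(h−1)` prefixes of leaves of `T`) having at least `δ` children, i.e. admitting at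
least `δ` distinct length-`h` extensions to leaves of `T`. -/
def trimTree (T : Finset (List ℕ)) (h δ : ℕ) : Finset (List ℕ) :=
  (T.image fun x => x.take (h - 1)).filter
    fun y => δ ≤ (T.filter fun x => x.take (h - 1) = y).card

theorem lcpLen_self_s13 (a : List ℕ) : lcpLen a a = a.length := by
  induction a with
  | nil => rfl
  | cons a x ih => simp [lcpLen, ih]

theorem lcpLen_take (k : ℕ) (a b : List ℕ) :
    lcpLen (a.take k) (b.take k) = min k (lcpLen a b) := by
  induction k generalizing a b with
  | zero => simp [lcpLen]
  | succ k ih =>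
    cases a with
    | nil => simp [lcpLen]
    | cons a x =>
      cases b with
      | nil => simp [lcpLen]
      | cons b y =>
        by_cases h : a = b
        · simp [lcpLen, h, ih]
        · simp [lcpLen, h]

theorem take_eq_take_of_le_lcpLen {k : ℕ} {a b : List ℕ} (h : k ≤ lcpLen a b) :
    a.take k = b.take k := by
  induction k generalizing a b with
  | zero => simp
  | succ k ih =>
    cases a with
    | nil => simp [lcpLen] at h
    | cons a x =>
      cases b with
      | nil => simp [lcpLen] at h
      | cons b y =>
        by_cases hab : a = b
        · simp only [lcpLen, hab, if_true, Nat.add_le_add_iff_right] at h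
          simp [hab, ih h]
        · simp [lcpLen, hab] at h

theorem lex_append_of_length_eq {x y : List ℕ} (h : List.Lex (· < ·) x y)
    (hl : x.length = y.length) (s t : List ℕ) :
    List.Lex (· < ·) (x ++ s) (y ++ t) := by
  induction h with
  | nil => simp at hl
  | cons _ ih => exact .cons (ih (by simpa using hl))
  | rel hab => exact .rel hab

theorem lex_take_of_take_ne {a b : List ℕ} (h : List.Lex (· < ·) a b) {k : ℕ}
    (hne : a.take k ≠ b.take k) : List.Lex (· < ·) (a.take k) (b.take k) := by
  induction h generalizing k with
  | nil =>
    cases k with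
    | zero => simp at hne
    | succ k => exact .nil
  | cons _ ih =>
    cases k with
    | zero => simp at hne
    | succ k => exact .cons (ih (by simpa using hne))
  | rel hab =>
    cases k with
    | zero => simp at hne
    | succ k => exact .rel hab

/-- A tree of height `k` embeds into the trimmed tree as soon as attaching `δ` children to each
of its leaves gives a tree with at most `n` leaves. -/
theorem treeEmbeds_trimTree {n k δ : ℕ} (hδ : 1 ≤ δ) {T : Finset (List ℕ)}
    (hT : UniversalTree n (k + 1) T) {L : Finset (List ℕ)} (hL : IsTree k L)
    (hcard : L.card * δ ≤ n) : TreeEmbeds L (trimTree T (k + 1) δ) := by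
  let L' : Finset (List ℕ) := (L ×ˢ Finset.range δ).image fun p => p.1 ++ [p.2]
  have mem {x : List ℕ} (hx : x ∈ L) {i : ℕ} (hi : i < δ) : x ++ [i] ∈ L' :=
    Finset.mem_image.2 ⟨(x, i), by simp [hx, hi], rfl⟩
  have tree : IsTree (k + 1) L' := by
    refine ⟨hL.1.elim fun x hx => ⟨_, mem hx hδ⟩, ?_⟩
    intro z hz
    obtain ⟨p, hp, rfl⟩ := Finset.mem_image.1 hz
    simp [hL.2 p.1 (Finset.mem_product.1 hp).1]
  have card : L'.card ≤ n := Finset.card_image_le.trans (by simpa using hcard)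
  obtain ⟨f, hfT, hfinj, hflex, hflcp⟩ := hT.2 L' tree card
  have take_append {x : List ℕ} (hx : x ∈ L) (i : ℕ) : (x ++ [i]).take k = x := by
    rw [← hL.2 x hx, List.take_left]
  have lcp {x y : List ℕ} (hx : x ∈ L) (hy : y ∈ L) {i j : ℕ} (hi : i < δ) (hj : j < δ) :
      lcpLen ((f (x ++ [i])).take k) ((f (y ++ [j])).take k) = lcpLen x y := by
    rw [lcpLen_take, hflcp _ (mem hx hi) _ (mem hy hj), ← lcpLen_take, take_append hx,
      take_append hy]
  have inj {x y : List ℕ} (hx : x ∈ L) (hy : y ∈ L)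
      (h : (f (x ++ [0])).take k = (f (y ++ [0])).take k) : x = y := by
    have hxy : k ≤ lcpLen x y := by
      rw [← lcp hx hy hδ hδ, h, lcp hy hy hδ hδ, lcpLen_self_s13, hL.2 y hy]
    have := take_eq_take_of_le_lcpLen hxy
    rwa [List.take_of_length_le (hL.2 x hx).le, List.take_of_length_le (hL.2 y hy).le] at this
  refine ⟨fun x => (f (x ++ [0])).take k, ?_, fun x hx y hy => inj hx hy, ?_,
    fun x hx y hy => lcp hx hy hδ hδ⟩
  · intro x hx
    refine Finset.mem_filter.2 ⟨Finset.mem_image.2 ⟨_, hfT _ (mem hx hδ), rfl⟩, ?_⟩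
    have himage : ((Finset.range δ).image fun i => f (x ++ [i])).card = δ := by
      rw [Finset.card_image_of_injOn, Finset.card_range]
      intro i hi j hj hij
      simpa using hfinj _ (mem hx (by simpa using hi)) _ (mem hx (by simpa using hj)) hij
    refine himage.ge.trans (Finset.card_le_card ?_)
    intro z hz
    obtain ⟨i, hi, rfl⟩ := Finset.mem_image.1 hz
    have hi := Finset.mem_range.1 hi
    refine Finset.mem_filter.2 ⟨hfT _ (mem hx hi), take_eq_take_of_le_lcpLen ?_⟩
    have := lcp hx hx hi hδ
    rw [lcpLen_take, lcpLen_self_s13, hL.2 x hx] at this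
    exact min_eq_left_iff.1 this
  · intro x hx y hy hxy
    refine lex_take_of_take_ne (hflex _ (mem hx hδ) _ (mem hy hδ) (lex_append_of_length_eq hxy
      ((hL.2 x hx).trans (hL.2 y hy).symm) _ _)) fun h => ?_
    obtain rfl := inj hx hy h
    exact irrefl_of (List.Lex (· < ·)) x hxy

/-- If `T` is `(n, h)`-universal with `h ≥ 2` and `δ ∈ {1, …, n}`, then
`T_δ` is `(⌊n/δ⌋, h−1)`-universal. -/
theorem trimTree_universal (n h δ : ℕ) (hh : 2 ≤ h) (hδ1 : 1 ≤ δ) (hδn : δ ≤ n)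
    (T : Finset (List ℕ)) (hT : UniversalTree n h T) :
    UniversalTree (n / δ) (h - 1) (trimTree T h δ) := by
  obtain ⟨k, rfl⟩ : ∃ k, h = k + 1 := ⟨h - 1, by omega⟩
  rw [Nat.add_sub_cancel]
  refine ⟨⟨?_, ?_⟩, fun L hL hcard => treeEmbeds_trimTree hδ1 hT hL
    ((Nat.le_div_iff_mul_le hδ1).1 hcard)⟩
  · obtain ⟨f, hf, -⟩ := treeEmbeds_trimTree hδ1 hT (L := {List.replicate k 0})
      (by simp [IsTree]) (by simpa using hδn)
    exact ⟨_, hf _ (Finset.mem_singleton_self _)⟩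
  · intro y hy
    obtain ⟨x, hx, rfl⟩ := Finset.mem_image.1 (Finset.mem_filter.1 hy).1
    simp [hT.1.2 x hx]
end

section
/- For all n, h ≥ 1, g(n, h) ≥ C(⌊log₂ n⌋ + h − 1, ⌊log₂ n⌋), where g is defined on pairs of positive integers by g(n, 1) = n, g(1, h) = 1, and, for n ≥ 2 and h ≥ 2, g(n, h) = Σ_{δ=1}^{n} g(⌊n/δ⌋, h−1). -/
theorem lbg_succ {n h : ℕ} (hn : 2 ≤ n) (hh : 1 ≤ h) :
    lbg n (h + 1) = ∑ δ ∈ Finset.Icc 1 n, lbg (n / δ) h := by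
  obtain ⟨n, rfl⟩ := Nat.exists_eq_add_of_le' hn
  obtain ⟨h, rfl⟩ := Nat.exists_eq_add_of_le' hh
  rw [lbg]

/-- A divisor sum dominates its part over the powers of two up to `n`. -/
theorem sum_pow_two_div_le {n : ℕ} (hn : 1 ≤ n) (f : ℕ → ℕ) :
    ∑ j ∈ Finset.range (Nat.log 2 n + 1), f (n / 2 ^ j) ≤ ∑ δ ∈ Finset.Icc 1 n, f (n / δ) := by
  rw [← Finset.sum_image (s := Finset.range (Nat.log 2 n + 1)) (g := fun j => 2 ^ j)
    (f := fun δ => f (n / δ)) (Nat.pow_right_injective le_rfl).injOn]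
  refine Finset.sum_le_sum_of_subset fun δ hδ => ?_
  obtain ⟨j, hj, rfl⟩ := Finset.mem_image.mp hδ
  exact Finset.mem_Icc.mpr ⟨Nat.one_le_two_pow, Nat.pow_le_of_le_log (by omega)
    (Nat.lt_succ_iff.mp (Finset.mem_range.mp hj))⟩

/-- The hockey-stick identity along the halvings of `n`. -/
theorem sum_choose_log_div_pow_two (n : ℕ) {h : ℕ} (hh : 1 ≤ h) :
    ∑ j ∈ Finset.range (Nat.log 2 n + 1),
        Nat.choose (Nat.log 2 (n / 2 ^ j) + h - 1) (Nat.log 2 (n / 2 ^ j)) =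
      Nat.choose (Nat.log 2 n + (h + 1) - 1) (Nat.log 2 n) := by
  obtain ⟨h, rfl⟩ := Nat.exists_eq_add_of_le' hh
  simp only [Nat.log_div_base_pow, ← add_assoc, Nat.add_sub_cancel, Nat.choose_symm_add]
  rw [add_assoc, Nat.choose_symm_add, ← add_assoc, ← Nat.sum_range_add_choose]
  exact Finset.sum_range_reflect (fun i => (i + h).choose h) (Nat.log 2 n + 1)

/-- For all `n, h ≥ 1`,
`g(n, h) ≥ C(⌊log₂ n⌋ + h − 1, ⌊log₂ n⌋)`. -/
theorem lbg_ge (n h : ℕ) (hn : 1 ≤ n) (hh : 1 ≤ h) :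
    Nat.choose (Nat.log 2 n + h - 1) (Nat.log 2 n) ≤ lbg n h := by
  induction h, hh using Nat.le_induction generalizing n with
  | base =>
    obtain ⟨n, rfl⟩ := Nat.exists_eq_add_of_le' hn
    simp [lbg]
  | succ h hh ih =>
    obtain rfl | hn2 := hn.eq_or_lt
    · obtain ⟨h, rfl⟩ := Nat.exists_eq_add_of_le' hh
      simp [lbg]
    rw [lbg_succ hn2 hh]
    refine le_trans ?_ (sum_pow_two_div_le hn fun m => lbg m h)
    rw [← sum_choose_log_div_pow_two n hh]
    refine Finset.sum_le_sum fun j hj => ih _ ?_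
    exact Nat.div_pos (Nat.pow_le_of_le_log (by omega)
      (Nat.lt_succ_iff.mp (Finset.mem_range.mp hj))) (by positivity)
end

section
/- The upper and lower bound functions for universal trees are polynomially related: for all n, h ≥ 1, f(n, h) ≤ 2·n·h·g(n, h), where f : ℕ × ℕ → ℕ is defined by f(0, h) = 0, f(n, 1) = n, f(1, h) = 1, and, for n ≥ 2 and h ≥ 2, f(n, h) = f(n, h−1) + f(⌊n/2⌋, h) + f(n − 1 − ⌊n/2⌋, h), and g is defined on pairs of positive integers by g(n, 1) = n, g(1, h) = 1, and, for n ≥ 2 and h ≥ 2, g(n, h) = Σ_{δ=1}^{n} g(⌊n/δ⌋, h−1). -/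
/-- For `n < 2 ^ (k + 1)`, Pascal's rule gives `f(n, h) ≤ 2 ^ (k + 1) * C(k + h, h)`. -/
theorem ubf_le_two_pow_mul_choose (h : ℕ) :
    ∀ k n : ℕ, n < 2 ^ (k + 1) → ubf n (h + 1) ≤ 2 ^ (k + 1) * (k + (h + 1)).choose (h + 1) := by
  induction h with
  | zero =>
    intro k n hn
    have hf : ubf n 1 = n := by cases n <;> simp [ubf]
    have hc : 0 < (k + 1).choose 1 := Nat.choose_pos (by omega)
    simp only [zero_add, hf]
    exact hn.le.trans (Nat.le_mul_of_pos_right _ hc)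
  | succ h ih =>
    intro k
    induction k with
    | zero =>
      intro n hn
      obtain rfl | rfl : n = 0 ∨ n = 1 := by omega
      · simp [ubf]
      · simp [ubf]
    | succ k ihk =>
      intro n hn
      match n with
      | 0 => simp [ubf]
      | 1 =>
        have hc : 0 < (k + 1 + (h + 1 + 1)).choose (h + 1 + 1) := Nat.choose_pos (by omega)
        rw [ubf]
        exact Nat.mul_pos (by positivity) hc
      | n + 2 =>
        have h₁ := ih (k + 1) (n + 2) hn
        rw [pow_succ] at hn
        have h₂ := ihk ((n + 2) / 2) (by omega)
        have h₃ := ihk (n + 2 - 1 - (n + 2) / 2) (by omega)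
        have pascal : (k + 1 + (h + 1 + 1)).choose (h + 1 + 1) =
            (k + 1 + (h + 1)).choose (h + 1) + (k + (h + 1 + 1)).choose (h + 1 + 1) := by
          rw [show k + 1 + (h + 1 + 1) = (k + 1 + (h + 1)) + 1 by ring, Nat.choose_succ_succ',
            show k + (h + 1 + 1) = k + 1 + (h + 1) by ring]
        rw [ubf, pascal]
        exact (add_le_add (add_le_add h₁ h₂) h₃).trans_eq (by ring)

/-- Keeping only the divisors `δ = 2 ^ i` in the sum gives `C(k + h, h) ≤ g(n, h)`
for `2 ^ k ≤ n`. -/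
theorem choose_le_lbg (h : ℕ) :
    ∀ k n : ℕ, 2 ^ k ≤ n → (k + (h + 1)).choose (h + 1) ≤ lbg n (h + 1) := by
  induction h with
  | zero =>
    intro k n hn
    have hg : lbg n 1 = n := by cases n <;> simp [lbg]
    have := Nat.lt_two_pow_self (n := k)
    simp only [zero_add, hg, Nat.choose_one_right]
    omega
  | succ h ih =>
    intro k n hn
    match n with
    | 0 => simp at hn
    | 1 =>
      have hk : k = 0 := by
        by_contra hk
        exact absurd hn (not_le.mpr (Nat.one_lt_two_pow hk))
      simp [lbg, hk]
    | n + 2 =>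
      rw [lbg]
      calc (k + (h + 1 + 1)).choose (h + 1 + 1)
          = ∑ i ∈ Finset.range (k + 1), (i + (h + 1)).choose (h + 1) :=
            (Nat.sum_range_add_choose k (h + 1)).symm
        _ = ∑ i ∈ Finset.range (k + 1), (k - i + (h + 1)).choose (h + 1) := by
            rw [← Finset.sum_range_reflect]
            simp
        _ ≤ ∑ i ∈ Finset.range (k + 1), lbg ((n + 2) / 2 ^ i) (h + 1) := by
            refine Finset.sum_le_sum fun i hi => ih _ _ ?_
            have hik : i ≤ k := Nat.lt_succ_iff.mp (Finset.mem_range.mp hi)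
            rw [Nat.le_div_iff_mul_le (by positivity), ← pow_add, Nat.sub_add_cancel hik]
            exact hn
        _ = ∑ δ ∈ (Finset.range (k + 1)).image (2 ^ ·), lbg ((n + 2) / δ) (h + 1) :=
            (Finset.sum_image (f := fun δ => lbg ((n + 2) / δ) (h + 1))
              fun _ _ _ _ hij => Nat.pow_right_injective le_rfl hij).symm
        _ ≤ ∑ δ ∈ Finset.Icc 1 (n + 2), lbg ((n + 2) / δ) (h + 1) := by
            refine Finset.sum_le_sum_of_subset fun δ hδ => ?_
            obtain ⟨i, hi, rfl⟩ := Finset.mem_image.mp hδ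
            have hik : i ≤ k := Nat.lt_succ_iff.mp (Finset.mem_range.mp hi)
            exact Finset.mem_Icc.mpr
              ⟨Nat.one_le_two_pow, (Nat.pow_le_pow_right two_pos hik).trans hn⟩

/-- The upper and lower bound functions for universal trees are polynomially
related: for all `n, h ≥ 1`, `f(n, h) ≤ 2·n·h·g(n, h)`. -/
theorem ubf_le_lbg (n h : ℕ) (hn : 1 ≤ n) (hh : 1 ≤ h) :
    ubf n h ≤ 2 * n * h * lbg n h := by
  obtain ⟨m, rfl⟩ := Nat.exists_eq_add_of_le' hh
  have hlog : 2 ^ Nat.log 2 n ≤ n := Nat.pow_log_le_self 2 (by omega)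
  calc ubf n (m + 1)
      ≤ 2 ^ (Nat.log 2 n + 1) * (Nat.log 2 n + (m + 1)).choose (m + 1) :=
        ubf_le_two_pow_mul_choose m _ n (Nat.lt_pow_succ_log_self one_lt_two n)
    _ ≤ 2 * n * lbg n (m + 1) :=
        Nat.mul_le_mul (by rw [pow_succ]; omega) (choose_le_lbg m _ n hlog)
    _ ≤ 2 * n * (m + 1) * lbg n (m + 1) :=
        Nat.mul_le_mul_right _ (Nat.le_mul_of_pos_right _ m.succ_pos)
end
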